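/- arXiv:1810.04210 — 4 statements merged into one kernel-verified Lean document; each statement's English description precedes it below -/
import Mathlib

section
/- The composition operator T_f on L^p(X,𝓑,μ) is Li-Yorke chaotic if and only if there exist an increasing sequence (α_j)_{j∈ℕ} of positive integers and a nonempty countable family (B_i)_{i∈I} of measurable sets with 0 < μ(B_i) < ∞ for every i ∈ I such that: (A) lim_{j→∞} μ(f^{-α_j}(B_i)) = 0 for every i ∈ I, and (B) sup{ μ(f^{-n}(B_i)) / μ(B_i) : i ∈ I, n ∈ ℕ } = ∞. -/
open MeasureTheory Filter Set Topology
open scoped ENNReal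

noncomputable section

/-- A continuous self-map `g` of a metric space is *Li-Yorke chaotic* if there is an
uncountable set `S` (a scrambled set) such that every pair of distinct points `x, y ∈ S`
satisfies `liminf dist (gⁿ x) (gⁿ y) = 0` and `limsup dist (gⁿ x) (gⁿ y) > 0`. -/
def LiYorkeChaotic {M : Type*} [PseudoMetricSpace M] (g : M → M) : Prop :=
  ∃ S : Set M, ¬ S.Countable ∧ ∀ x ∈ S, ∀ y ∈ S, x ≠ y →
    (∀ ε > 0, ∃ᶠ n in atTop, dist (g^[n] x) (g^[n] y) < ε) ∧
    (∃ ε > 0, ∃ᶠ n in atTop, ε < dist (g^[n] x) (g^[n] y))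

/-- A continuous linear operator that tends to zero pointwise along a common subsequence of its
powers on a family of vectors, but whose powers are not uniformly bounded on that family, is
Li-Yorke chaotic. -/
theorem LiYorkeChaotic.of_tendsto_zero_of_unbounded {E : Type*} [NormedAddCommGroup E]
    [NormedSpace ℝ E] [CompleteSpace E] (T : E →L[ℝ] E) {ι : Type*} (e : ι → E) {α : ℕ → ℕ}
    (hα : Tendsto α atTop atTop) (hzero : ∀ i, Tendsto (fun j => (T ^ α j) (e i)) atTop (𝓝 0))
    (hunb : ∀ K : ℝ, ∃ i n, K * ‖e i‖ < ‖(T ^ n) (e i)‖) : LiYorkeChaotic T := by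
  set Y : Submodule ℝ E := (Submodule.span ℝ (range e)).topologicalClosure
  have hYc : IsClosed (Y : Set E) := Submodule.isClosed_topologicalClosure _
  have : CompleteSpace Y := hYc.completeSpace_coe
  have hle : Submodule.span ℝ (range e) ≤ Y := Submodule.le_topologicalClosure _
  have heY : ∀ i, e i ∈ Y := fun i => hle (Submodule.subset_span ⟨i, rfl⟩)
  have hspan : ∀ y ∈ Submodule.span ℝ (range e),
      Tendsto (fun j => (T ^ α j) y) atTop (𝓝 0) := by
    intro y hy
    induction hy using Submodule.span_induction with
    | mem x hx => obtain ⟨i, rfl⟩ := hx; exact hzero i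
    | zero => simp
    | add x y _ _ hx hy => simpa using hx.add hy
    | smul a x _ hx => simpa using hx.const_smul a
  have hcont : ∀ n, Continuous fun y : Y => ‖(T ^ n) (y : E)‖ := fun n => by fun_prop
  have hsmall : ∀ k : ℕ × ℕ,
      Dense (⋃ n ≥ k.1, {y : Y | ‖(T ^ n) (y : E)‖ < 1 / ((k.2 : ℝ) + 1)}) := by
    rintro ⟨N, k⟩
    have hd : Dense {y : Y | (y : E) ∈ Submodule.span ℝ (range e)} := by
      intro y
      rw [closure_subtype]
      have h1 : ((↑) : Y → E) '' {y : Y | (y : E) ∈ Submodule.span ℝ (range e)}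
          = (Submodule.span ℝ (range e) : Set E) := by
        ext z
        constructor
        · rintro ⟨w, hw, rfl⟩; exact hw
        · intro hz; exact ⟨⟨z, hle hz⟩, hz, rfl⟩
      rw [h1, ← Submodule.topologicalClosure_coe]
      exact y.2
    refine hd.mono fun y hy => ?_
    have h2 := (hspan y hy).norm
    rw [norm_zero] at h2
    obtain ⟨j, hj, hjN⟩ := ((h2.eventually_lt_const
      (Nat.one_div_pos_of_nat (α := ℝ) (n := k))).and (hα.eventually_ge_atTop N)).exists
    exact mem_iUnion₂.2 ⟨α j, hjN, hj⟩
  have hlarge : ∀ M : ℕ, Dense (⋃ n, {y : Y | (M : ℝ) < ‖(T ^ n) (y : E)‖}) := by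
    intro M
    rw [← compl_compl (⋃ n, _), ← interior_eq_empty_iff_dense_compl,
      eq_empty_iff_forall_notMem]
    intro y₀ hy₀
    obtain ⟨r, hr, hball⟩ := Metric.mem_nhds_iff.1 (mem_interior_iff_mem_nhds.1 hy₀)
    have hb : ∀ y ∈ Metric.ball y₀ r, ∀ n, ‖(T ^ n) (y : E)‖ ≤ M := by
      intro y hy n
      have := hball hy
      simp only [mem_compl_iff, mem_iUnion, mem_ofPred_eq, not_exists, not_lt] at this
      exact this n
    obtain ⟨i, n, hin⟩ := hunb (4 * M / r)
    have hne : 0 < ‖e i‖ := by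
      rw [norm_pos_iff]
      intro h
      simp [h] at hin
    set t : ℝ := r / (2 * ‖e i‖) with ht
    have htpos : 0 < t := by positivity
    have hy1 : y₀ + t • (⟨e i, heY i⟩ : Y) ∈ Metric.ball y₀ r := by
      rw [mem_ball_iff_norm, add_sub_cancel_left, norm_smul, Real.norm_of_nonneg htpos.le]
      change t * ‖e i‖ < r
      rw [ht]; field_simp; linarith
    have h1 := hb _ hy1 n
    have h0 := hb _ (Metric.mem_ball_self hr) n
    have h3 : t * ‖(T ^ n) (e i)‖ ≤ 2 * M := by
      have : (T ^ n) (t • e i) =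
          (T ^ n) ((y₀ + t • (⟨e i, heY i⟩ : Y) : Y) : E) - (T ^ n) (y₀ : E) := by
        rw [← map_sub]; simp only [Submodule.coe_add, Submodule.coe_smul, add_sub_cancel_left]
      rw [← Real.norm_of_nonneg htpos.le, ← norm_smul, ← map_smul, this]
      exact (norm_sub_le _ _).trans (by linarith)
    have h4 := mul_lt_mul_of_pos_left hin htpos
    have h5 : t * (4 * M / r * ‖e i‖) = 2 * M := by
      rw [ht]; field_simp; ring
    linarith
  have hso : ∀ k : ℕ × ℕ,
      IsOpen (⋃ n ≥ k.1, {y : Y | ‖(T ^ n) (y : E)‖ < 1 / ((k.2 : ℝ) + 1)}) := fun k =>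
    isOpen_biUnion fun n _ => isOpen_lt (hcont n) continuous_const
  have hlo : ∀ M : ℕ, IsOpen (⋃ n, {y : Y | (M : ℝ) < ‖(T ^ n) (y : E)‖}) := fun M =>
    isOpen_iUnion fun n => isOpen_lt continuous_const (hcont n)
  obtain ⟨⟨y, hyY⟩, hys, hyl⟩ := ((dense_iInter_of_isOpen hso hsmall).inter_of_Gδ
    (IsGδ.iInter_of_isOpen hso) (IsGδ.iInter_of_isOpen hlo)
    (dense_iInter_of_isOpen hlo hlarge)).nonempty
  simp only [mem_iInter, mem_iUnion, mem_ofPred_eq, exists_prop, Prod.forall] at hys hyl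
  have hdist : ∀ (a b : ℝ) (n : ℕ),
      dist (T^[n] (a • y)) (T^[n] (b • y)) = |a - b| * ‖(T ^ n) y‖ := by
    intro a b n
    rw [← FunLike.coe_pow_eq_iterate, dist_eq_norm, ← map_sub, ← sub_smul, map_smul, norm_smul,
      Real.norm_eq_abs]
  have hy0 : y ≠ 0 := by
    rintro rfl
    obtain ⟨n, hn⟩ := hyl 0
    simp at hn
  refine ⟨range fun a : ℝ => a • y, fun hc => ?_, ?_⟩
  · rw [← image_univ] at hc
    exact Cardinal.not_countable_real
      (countable_of_injective_of_countable_image (smul_left_injective ℝ hy0).injOn hc)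
  rintro _ ⟨a, rfl⟩ _ ⟨b, rfl⟩ hab
  have hab' : 0 < |a - b| := abs_pos.2 (sub_ne_zero.2 fun h => hab (by simp [h]))
  simp only [hdist]
  refine ⟨fun ε hε => frequently_atTop.2 fun N => ?_, 1, one_pos, fun hev => ?_⟩
  · obtain ⟨k, hk⟩ := exists_nat_one_div_lt (div_pos hε hab')
    obtain ⟨n, hn, h⟩ := hys N k
    exact ⟨n, hn, (lt_div_iff₀' hab').1 (h.trans hk)⟩
  · obtain ⟨N, hN⟩ := eventually_atTop.1 hev
    obtain ⟨M, hM⟩ := exists_nat_gt (1 / |a - b| + ∑ n ∈ Finset.range N, ‖(T ^ n) y‖)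
    obtain ⟨n, hn⟩ := hyl M
    have hs : 0 ≤ ∑ n ∈ Finset.range N, ‖(T ^ n) y‖ := by positivity
    rcases lt_or_ge n N with h | h
    · have := Finset.single_le_sum (f := fun n => ‖(T ^ n) y‖) (fun _ _ => norm_nonneg _)
        (Finset.mem_range.2 h)
      have : 0 < 1 / |a - b| := by positivity
      simp only at *
      linarith
    · refine hN n h ?_
      beta_reduce
      rw [← div_lt_iff₀' hab']
      linarith

/-- If `ν` is dominated by `C • μ` on the dyadic level sets of `G`, then the integral of `G`
against `ν` is at most `2 * C` times its integral against `μ`. -/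
theorem lintegral_le_of_measure_dyadic_le {X : Type*} [MeasurableSpace X] {μ ν : Measure X}
    {G : X → ℝ≥0∞} (hG : Measurable G) (hG_top : ∀ x, G x ≠ ∞) {C : ℝ≥0∞}
    (h : ∀ k : ℤ, ν (G ⁻¹' Ico (2 ^ k) (2 ^ (k + 1))) ≤ C * μ (G ⁻¹' Ico (2 ^ k) (2 ^ (k + 1)))) :
    ∫⁻ x, G x ∂ν ≤ 2 * C * ∫⁻ x, G x ∂μ := by
  set B : ℤ → Set X := fun k => G ⁻¹' Ico (2 ^ k) (2 ^ (k + 1))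
  have hBm : ∀ k, MeasurableSet (B k) := fun k => hG measurableSet_Ico
  have hdisj : Pairwise (Function.onFun Disjoint B) := by
    have hmono : Monotone fun k : ℤ => (2 : ℝ≥0∞) ^ k := ENNReal.monotone_zpow one_le_two
    exact fun i j hij => (hmono.pairwise_disjoint_on_Ico_succ hij).preimage G
  have hpow : ∀ k : ℤ, (2 : ℝ≥0∞) ^ (k + 1) = 2 * 2 ^ k := fun k => by
    rw [ENNReal.zpow_add two_ne_zero ENNReal.ofNat_ne_top, zpow_one, mul_comm]
  have hsupp : Function.support G = ⋃ k, B k := by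
    ext x
    simp only [Function.mem_support, mem_iUnion]
    refine ⟨fun hx => ?_, ?_⟩
    · exact ENNReal.exists_mem_Ico_zpow hx (hG_top x) ENNReal.one_lt_two ENNReal.ofNat_ne_top
    · rintro ⟨k, hk⟩ h0
      have : (2 : ℝ≥0∞) ^ k ≤ 0 := h0 ▸ hk.1
      exact (ENNReal.zpow_pos two_ne_zero ENNReal.ofNat_ne_top k).not_ge this
  have hsplit : ∀ ρ : Measure X, ∫⁻ x, G x ∂ρ = ∑' k, ∫⁻ x in B k, G x ∂ρ := fun ρ => by
    rw [← lintegral_iUnion hBm hdisj, ← hsupp, setLIntegral_eq_of_support_subset subset_rfl]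
  rw [hsplit, hsplit, ← ENNReal.tsum_mul_left]
  refine ENNReal.tsum_le_tsum fun k => ?_
  calc ∫⁻ x in B k, G x ∂ν ≤ ∫⁻ _ in B k, 2 ^ (k + 1) ∂ν :=
        setLIntegral_mono' (hBm k) fun x hx => hx.2.le
    _ = 2 * 2 ^ k * ν (B k) := by rw [setLIntegral_const, hpow]
    _ ≤ 2 * 2 ^ k * (C * μ (B k)) := by gcongr; exact h k
    _ = 2 * C * ∫⁻ _ in B k, 2 ^ k ∂μ := by rw [setLIntegral_const]; ring
    _ ≤ 2 * C * ∫⁻ x in B k, G x ∂μ := by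
        refine mul_le_mul_right ?_ _
        exact setLIntegral_mono' (hBm k) fun x hx => hx.1

theorem quasiMeasurePreserving_of_mul_le_measure_image {X : Type*} [MeasurableSpace X]
    {μ : Measure X} {f : X → X} (hf : Measurable f) {c : ℝ≥0∞} (hc : 0 < c)
    (hcf : ∀ B : Set X, MeasurableSet B → c * μ B ≤ μ (f '' B)) :
    Measure.QuasiMeasurePreserving f μ μ := by
  refine ⟨hf, Measure.AbsolutelyContinuous.mk fun s hs h0 => ?_⟩
  rw [Measure.map_apply hf hs]
  have h := (hcf _ (hf hs)).trans (measure_mono (image_preimage_subset f s))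
  rw [h0, nonpos_iff_eq_zero, mul_eq_zero] at h
  exact h.resolve_left hc.ne'

/-- The iterates of a composition operator are composition with the iterates. -/
theorem coeFn_iterate_composition_ae_eq {X : Type*} [MeasurableSpace X] {μ : Measure X} {p : ℝ≥0∞}
    {f : X → X} (hf : Measure.QuasiMeasurePreserving f μ μ)
    {T : Lp ℝ p μ → Lp ℝ p μ} (hT : ∀ φ : Lp ℝ p μ, ⇑(T φ) =ᵐ[μ] fun x => φ (f x))
    (φ : Lp ℝ p μ) (n : ℕ) : ⇑(T^[n] φ) =ᵐ[μ] φ ∘ f^[n] := by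
  induction n generalizing φ with
  | zero => rfl
  | succ n ih =>
    rw [Function.iterate_succ_apply, Function.iterate_succ', ← Function.comp_assoc]
    exact (ih (T φ)).trans ((hf.iterate n).ae_eq_comp (hT φ))

theorem enorm_rpow_iterate_composition {X : Type*} [MeasurableSpace X] {μ : Measure X} {p : ℝ≥0∞}
    (hp0 : p ≠ 0) (hp : p ≠ ∞) {f : X → X} (hf : Measure.QuasiMeasurePreserving f μ μ)
    {T : Lp ℝ p μ → Lp ℝ p μ} (hT : ∀ φ : Lp ℝ p μ, ⇑(T φ) =ᵐ[μ] fun x => φ (f x))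
    (φ : Lp ℝ p μ) (n : ℕ) :
    ‖T^[n] φ‖ₑ ^ p.toReal = ∫⁻ x, ‖φ (f^[n] x)‖ₑ ^ p.toReal ∂μ := by
  rw [Lp.enorm_def, eLpNorm_congr_ae (coeFn_iterate_composition_ae_eq hf hT φ n),
    eLpNorm_eq_lintegral_rpow_enorm_toReal hp0 hp, ← ENNReal.rpow_mul,
    one_div_mul_cancel (ENNReal.toReal_pos hp0 hp).ne', ENNReal.rpow_one]
  rfl

theorem enorm_rpow_iterate_composition_indicatorConstLp {X : Type*} [MeasurableSpace X]
    {μ : Measure X} {p : ℝ≥0∞}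
    (hp0 : p ≠ 0) (hp : p ≠ ∞) {f : X → X} (hf : Measure.QuasiMeasurePreserving f μ μ)
    {T : Lp ℝ p μ → Lp ℝ p μ} (hT : ∀ φ : Lp ℝ p μ, ⇑(T φ) =ᵐ[μ] fun x => φ (f x))
    {B : Set X} (hB : MeasurableSet B) (hμB : μ B ≠ ∞) (n : ℕ) :
    ‖T^[n] (indicatorConstLp p hB hμB 1)‖ₑ ^ p.toReal = μ (f^[n] ⁻¹' B) := by
  have hn := hf.iterate n
  rw [enorm_rpow_iterate_composition hp0 hp hf hT, ← lintegral_indicator_one (hn.measurable hB)]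
  refine lintegral_congr_ae ((hn.ae_eq_comp
    (indicatorConstLp_coeFn (p := p) (hs := hB) (hμs := hμB) (c := (1 : ℝ)))).mono fun x hx => ?_)
  rw [Function.comp_apply, Function.comp_apply] at hx
  beta_reduce
  rw [hx]
  by_cases h : f^[n] x ∈ B <;> simp [h, ENNReal.toReal_pos hp0 hp]

/-- A family of measurable sets of finite positive measure satisfying (A) and (B) makes the
composition operator Li-Yorke chaotic. -/
theorem LiYorkeChaotic.of_family {X : Type*} [MeasurableSpace X] {μ : Measure X}
    {p : ℝ≥0∞} [Fact (1 ≤ p)] (hp : p ≠ ∞) {f : X → X} (hf : Measure.QuasiMeasurePreserving f μ μ)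
    (T : Lp ℝ p μ →L[ℝ] Lp ℝ p μ) (hT : ∀ φ : Lp ℝ p μ, ⇑(T φ) =ᵐ[μ] fun x => φ (f x))
    {α : ℕ → ℕ} (hα : Tendsto α atTop atTop) {ι : Type*} {B : ι → Set X}
    (hB : ∀ i, MeasurableSet (B i) ∧ 0 < μ (B i) ∧ μ (B i) < ∞)
    (hzero : ∀ i, Tendsto (fun j => μ (f^[α j] ⁻¹' B i)) atTop (𝓝 0))
    (hsup : (⨆ (i : ι) (n : ℕ), μ (f^[n] ⁻¹' B i) / μ (B i)) = ∞) : LiYorkeChaotic T := by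
  have hp0 : p ≠ 0 := (zero_lt_one.trans_le (Fact.out : 1 ≤ p)).ne'
  have hq : 0 < p.toReal := ENNReal.toReal_pos hp0 hp
  have hnorm := fun i n => enorm_rpow_iterate_composition_indicatorConstLp hp0 hp hf hT
    (hB i).1 (hB i).2.2.ne n
  refine .of_tendsto_zero_of_unbounded T
    (fun i => indicatorConstLp p (hB i).1 (hB i).2.2.ne (1 : ℝ)) hα (fun i => ?_) fun K => ?_
  · rw [tendsto_iff_enorm_sub_tendsto_zero]
    have h := ((ENNReal.continuous_rpow_const (y := p.toReal⁻¹)).tendsto 0).comp (hzero i)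
    rw [ENNReal.zero_rpow_of_pos (inv_pos.2 hq)] at h
    refine h.congr fun j => ?_
    rw [Function.comp_apply, ← hnorm, ENNReal.rpow_rpow_inv hq.ne', sub_zero,
      FunLike.coe_pow_eq_iterate]
  · by_contra! hle
    refine (ENNReal.rpow_lt_top_of_nonneg hq.le (ENNReal.ofReal_ne_top (r := K))).not_ge ?_
    rw [← hsup]
    refine iSup₂_le fun i n => ENNReal.div_le_of_le_mul ?_
    have h0 := hnorm i 0
    rw [Function.iterate_zero, id, Function.iterate_zero, preimage_id] at h0
    rw [← h0, ← hnorm, ← ENNReal.mul_rpow_of_nonneg _ _ hq.le]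
    gcongr
    rw [← ofReal_norm, ← ofReal_norm, ← ENNReal.ofReal_mul' (norm_nonneg _),
      ← FunLike.coe_pow_eq_iterate]
    exact ENNReal.ofReal_le_ofReal (hle i n)

/-- If the composition operator is Li-Yorke chaotic, then the preimages under the iterates of `f`
of the dyadic level sets of a difference of two scrambled vectors form a family satisfying (A)
and (B). -/
theorem LiYorkeChaotic.exists_family {X : Type*} [MeasurableSpace X] {μ : Measure X}
    {p : ℝ≥0∞} [Fact (1 ≤ p)] (hp : p ≠ ∞) {f : X → X} (hf : Measure.QuasiMeasurePreserving f μ μ)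
    (T : Lp ℝ p μ →L[ℝ] Lp ℝ p μ) (hT : ∀ φ : Lp ℝ p μ, ⇑(T φ) =ᵐ[μ] fun x => φ (f x))
    (h : LiYorkeChaotic T) :
    ∃ α : ℕ → ℕ, StrictMono α ∧ (∀ j, 0 < α j) ∧
      ∃ (I : Type) (_ : Countable I) (_ : Nonempty I) (B : I → Set X),
        (∀ i, MeasurableSet (B i) ∧ 0 < μ (B i) ∧ μ (B i) < ∞) ∧
        (∀ i, Tendsto (fun j => μ (f^[α j] ⁻¹' B i)) atTop (𝓝 0)) ∧
        (⨆ (i : I) (n : ℕ), μ (f^[n] ⁻¹' B i) / μ (B i)) = ∞ := by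
  have hp0 : p ≠ 0 := (zero_lt_one.trans_le (Fact.out : 1 ≤ p)).ne'
  have hq : 0 < p.toReal := ENNReal.toReal_pos hp0 hp
  obtain ⟨S, hS, hpair⟩ := h
  obtain ⟨x, hx, y, hy, hxy⟩ : S.Nontrivial := by
    rw [← not_subsingleton_iff]
    exact fun hs => hS hs.countable
  obtain ⟨hlim, ε, hε, hsup⟩ := hpair x hx y hy hxy
  set φ := x - y with hφ
  have hdist : ∀ n, dist (T^[n] x) (T^[n] y) = ‖T^[n] φ‖ := fun n => by
    simp only [← FunLike.coe_pow_eq_iterate, hφ, map_sub, dist_eq_norm]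
  simp only [hdist] at hlim hsup
  set G : X → ℝ≥0∞ := fun z => ‖φ z‖ₑ ^ p.toReal
  have hGm : Measurable G := (Lp.stronglyMeasurable φ).enorm.pow_const _
  have hG_top : ∀ z, G z ≠ ∞ := fun z => ENNReal.rpow_ne_top_of_nonneg hq.le enorm_ne_top
  have hfm : ∀ n, Measurable f^[n] := fun n => (hf.iterate n).measurable
  have hint : ∀ n, ‖T^[n] φ‖ₑ ^ p.toReal = ∫⁻ z, G (f^[n] z) ∂μ :=
    enorm_rpow_iterate_composition hp0 hp hf hT φ
  set A : ℤ → Set X := fun k => G ⁻¹' Ico (2 ^ k) (2 ^ (k + 1))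
  have hAm : ∀ k, MeasurableSet (A k) := fun k => hGm measurableSet_Ico
  have hmarkov : ∀ k n, (2 : ℝ≥0∞) ^ k * μ (f^[n] ⁻¹' A k) ≤ ‖T^[n] φ‖ₑ ^ p.toReal := by
    intro k n
    rw [hint]
    refine le_trans ?_ (mul_meas_ge_le_lintegral (hGm.comp (hfm n)) (2 ^ k))
    gcongr
    exact fun z hz => hz.1
  have hmarkov' : ∀ k n, μ (f^[n] ⁻¹' A k) ≤ ((2 : ℝ≥0∞) ^ k)⁻¹ * ‖T^[n] φ‖ₑ ^ p.toReal := by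
    intro k n
    rw [mul_comm, ← div_eq_mul_inv, ENNReal.le_div_iff_mul_le
      (.inl (ENNReal.zpow_pos two_ne_zero ENNReal.ofNat_ne_top k).ne')
      (.inl (ENNReal.zpow_lt_top two_ne_zero ENNReal.ofNat_ne_top k).ne), mul_comm]
    exact hmarkov k n
  have hinv : ∀ k : ℤ, ((2 : ℝ≥0∞) ^ k)⁻¹ ≠ ∞ := fun k =>
    ENNReal.inv_ne_top.2 (ENNReal.zpow_pos two_ne_zero ENNReal.ofNat_ne_top k).ne'
  have hfin : ∀ k n, μ (f^[n] ⁻¹' A k) < ∞ := fun k n => (hmarkov' k n).trans_lt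
    (ENNReal.mul_lt_top (hinv k).lt_top (ENNReal.rpow_lt_top_of_nonneg hq.le enorm_ne_top))
  obtain ⟨α, hα, hαP⟩ := extraction_forall_of_frequently
    (P := fun j n => ‖T^[n] φ‖ < 1 / ((j : ℝ) + 1) ∧ 0 < n)
    fun j => (hlim _ Nat.one_div_pos_of_nat).and_eventually (eventually_gt_atTop 0)
  have hTα : Tendsto (fun j => T^[α j] φ) atTop (𝓝 0) :=
    squeeze_zero_norm (fun j => (hαP j).1.le) tendsto_one_div_add_atTop_nhds_zero_nat
  have hTα' : ∀ m, Tendsto (fun j => ‖T^[m + α j] φ‖ₑ ^ p.toReal) atTop (𝓝 0) := by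
    intro m
    have h1 := (((T ^ m).continuous.tendsto 0).comp hTα).enorm
    rw [map_zero, enorm_zero] at h1
    have h2 := ((ENNReal.continuous_rpow_const (y := p.toReal)).tendsto 0).comp h1
    rw [ENNReal.zero_rpow_of_pos hq] at h2
    refine h2.congr fun j => ?_
    simp only [Function.comp_apply, FunLike.coe_pow_eq_iterate, Function.iterate_add_apply]
  have hpre : ∀ m n k, f^[n] ⁻¹' (f^[m] ⁻¹' A k) = f^[m + n] ⁻¹' A k := fun m n k => by
    rw [← preimage_comp, ← Function.iterate_add]
  let B : {i : ℤ × ℕ // 0 < μ (f^[i.2] ⁻¹' A i.1)} → Set X := fun i => f^[i.1.2] ⁻¹' A i.1.1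
  have hunb : (⨆ (i) (n : ℕ), μ (f^[n] ⁻¹' B i) / μ (B i)) = ∞ := by
    by_contra hC
    set C := ⨆ (i) (n : ℕ), μ (f^[n] ⁻¹' B i) / μ (B i)
    have hle : ∀ m n, ‖T^[m + n] φ‖ₑ ^ p.toReal ≤ 2 * C * ‖T^[m] φ‖ₑ ^ p.toReal := by
      intro m n
      rw [hint, hint, ← lintegral_map hGm (hfm _), ← lintegral_map hGm (hfm _)]
      refine lintegral_le_of_measure_dyadic_le hGm hG_top fun k => ?_
      rw [Measure.map_apply (hfm _) (hAm k), Measure.map_apply (hfm _) (hAm k)]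
      rcases eq_zero_or_pos (μ (f^[m] ⁻¹' A k)) with h0 | hpos
      · rw [← hpre, (hf.iterate n).preimage_null h0]
        exact zero_le
      · rw [← hpre, ← ENNReal.div_le_iff hpos.ne' (hfin k m).ne]
        exact le_iSup₂_of_le (f := fun i (n : ℕ) => μ (f^[n] ⁻¹' B i) / μ (B i))
          ⟨(k, m), hpos⟩ n le_rfl
    have h1 : Tendsto (fun j => 2 * C * ‖T^[α j] φ‖ₑ ^ p.toReal) atTop (𝓝 0) := by
      have := ENNReal.Tendsto.const_mul (hTα' 0)
        (.inr (ENNReal.mul_ne_top ENNReal.ofNat_ne_top hC : 2 * C ≠ ∞))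
      simpa only [mul_zero, zero_add] using this
    have hεpos : 0 < ENNReal.ofReal ε ^ p.toReal :=
      ENNReal.rpow_pos (ENNReal.ofReal_pos.2 hε) ENNReal.ofReal_ne_top
    obtain ⟨j, hj⟩ := (h1.eventually_lt_const hεpos).exists
    obtain ⟨n, hn, hn'⟩ := frequently_atTop.1 hsup (α j)
    obtain ⟨d, rfl⟩ := Nat.exists_eq_add_of_le hn
    have h2 := (ENNReal.rpow_lt_rpow_iff hq).1 ((hle (α j) d).trans_lt hj)
    rw [← ofReal_norm] at h2
    exact h2.not_ge (ENNReal.ofReal_le_ofReal hn'.le)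
  refine ⟨α, hα, fun j => (hαP j).2, _, inferInstance, ?_, B, fun i => ?_, fun i => ?_, hunb⟩
  · by_contra hne
    rw [not_nonempty_iff] at hne
    rw [iSup_of_empty] at hunb
    exact ENNReal.zero_ne_top hunb
  · exact ⟨hfm _ (hAm _), i.2, hfin _ _⟩
  · have h1 := ENNReal.Tendsto.const_mul (hTα' i.1.2) (.inr (hinv i.1.1))
    rw [mul_zero] at h1
    refine tendsto_of_tendsto_of_tendsto_of_le_of_le tendsto_const_nhds h1 (fun _ => zero_le)
      fun j => ?_
    simp only [B, hpre]
    exact hmarkov' _ _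

/-- **Theorem 1 (characterization of Li-Yorke chaos for composition operators).**
The composition operator `T_f` on `L^p(X,𝓑,μ)` is Li-Yorke chaotic if and only if there
exist an increasing sequence `(α_j)` of positive integers and a nonempty countable family
`(B_i)_{i ∈ I}` of measurable sets of finite positive measure such that
(A) `μ(f^{-α_j}(B_i)) → 0` for every `i`, and
(B) `sup { μ(f^{-n}(B_i)) / μ(B_i) : i ∈ I, n ∈ ℕ } = ∞`. -/
theorem liYorke_iff_exists_family
    {X : Type*} [MeasurableSpace X] (μ : Measure X) (hX : μ Set.univ ≠ 0)
    (p : ℝ≥0∞) [Fact (1 ≤ p)] (hp : p ≠ ∞)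
    (f : X → X) (hf : Measurable f)
    (hfim : ∀ B : Set X, MeasurableSet B → MeasurableSet (f '' B))
    (c : ℝ≥0∞) (hc : 0 < c)
    (hcf : ∀ B : Set X, MeasurableSet B → c * μ B ≤ μ (f '' B))
    (T : Lp ℝ p μ →L[ℝ] Lp ℝ p μ)
    (hT : ∀ φ : Lp ℝ p μ, ⇑(T φ) =ᵐ[μ] fun x => φ (f x)) :
    LiYorkeChaotic (⇑T) ↔
      ∃ α : ℕ → ℕ, StrictMono α ∧ (∀ j, 0 < α j) ∧
        ∃ (I : Type) (_ : Countable I) (_ : Nonempty I) (B : I → Set X),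
          (∀ i, MeasurableSet (B i) ∧ 0 < μ (B i) ∧ μ (B i) < ∞) ∧
          (∀ i, Tendsto (fun j => μ (f^[α j] ⁻¹' B i)) atTop (𝓝 0)) ∧
          (⨆ (i : I) (n : ℕ), μ (f^[n] ⁻¹' B i) / μ (B i)) = ∞ := by
  have hqmp := quasiMeasurePreserving_of_mul_le_measure_image hf hc hcf
  refine ⟨fun h => h.exists_family hp hqmp T hT, ?_⟩
  rintro ⟨α, hα, -, I, -, -, B, hB, hzero, hsup⟩
  exact .of_family hp hqmp T hT hα.tendsto_atTop hB hzero hsup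
end
end

section
/- Assume in addition that f is injective. If there exists a measurable set B with 0 < μ(B) < ∞ such that (i) liminf_{n→∞} μ(f^{-n}(B)) = 0 and (ii) sup{ μ(f^n(B)) / μ(f^m(B)) : n ∈ ℤ, m ∈ I, n < m } = ∞, where I = { m ∈ ℤ : 0 < μ(f^m(B)) < ∞ }, then the composition operator T_f is Li-Yorke chaotic. -/
open MeasureTheory Filter Set Topology
open scoped ENNReal

noncomputable section

/-- For `k : ℤ`, `iterSet f k B` is the set `f^k(B)`: the image of `B` under the `k`-th
iterate of `f` when `k ≥ 0`, and the preimage of `B` under the `|k|`-th iterate of `f`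
when `k < 0`. -/
def iterSet {X : Type*} (f : X → X) (k : ℤ) (B : Set X) : Set X :=
  if 0 ≤ k then f^[k.toNat] '' B else f^[(-k).toNat] ⁻¹' B

/-- A linear operator with a semi-irregular vector is Li-Yorke chaotic: the line spanned by the
vector is scrambled. -/
lemma LiYorkeChaotic.of_semiIrregular {E : Type*} [NormedAddCommGroup E] [NormedSpace ℝ E]
    (T : E →L[ℝ] E) (x : E) (h0 : ∀ ε > 0, ∃ᶠ n in atTop, ‖(T ^ n) x‖ < ε)
    (h1 : ∃ ε > 0, ∃ᶠ n in atTop, ε < ‖(T ^ n) x‖) : LiYorkeChaotic (⇑T) := by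
  obtain ⟨ε, hε, h1⟩ := h1
  have hx : x ≠ 0 := by
    rintro rfl
    obtain ⟨n, hn⟩ := h1.exists
    simp only [map_zero, norm_zero] at hn
    exact lt_asymm hε hn
  have hdist (s t : ℝ) (n : ℕ) :
      dist (T^[n] (s • x)) (T^[n] (t • x)) = |s - t| * ‖(T ^ n) x‖ := by
    rw [← FunLike.coe_pow_eq_iterate, map_smul, map_smul, dist_eq_norm, ← sub_smul, norm_smul,
      Real.norm_eq_abs]
  refine ⟨range fun t : ℝ => t • x, fun hS => ?_, ?_⟩
  · exact not_countable_univ (countable_of_injective_of_countable_image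
      (smul_left_injective ℝ hx).injOn (image_univ ▸ hS))
  · rintro _ ⟨s, rfl⟩ _ ⟨t, rfl⟩ hst
    have hpos : 0 < |s - t| := abs_pos.2 (sub_ne_zero.2 fun h => hst (by rw [h]))
    simp only [hdist]
    refine ⟨fun δ hδ => ?_, |s - t| * ε, mul_pos hpos hε, ?_⟩
    · refine (h0 (δ / |s - t|) (div_pos hδ hpos)).mono fun n hn => ?_
      rwa [lt_div_iff₀' hpos] at hn
    · exact h1.mono fun n hn => (mul_lt_mul_iff_right₀ hpos).2 hn

/-- If the orbits of all vectors of `S` under `T` tend to zero but the powers of `T` are not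
uniformly bounded on `S`, then `T` has a semi-irregular vector. -/
lemma exists_semiIrregular_of_unbounded {E : Type*} [NormedAddCommGroup E] [NormedSpace ℝ E]
    [CompleteSpace E] (T : E →L[ℝ] E) (S : Set E)
    (hS : ∀ x ∈ S, Tendsto (fun n => (T ^ n) x) atTop (𝓝 0))
    (hub : ∀ C : ℝ, ∃ x ∈ S, ∃ n : ℕ, C * ‖x‖ < ‖(T ^ n) x‖) :
    ∃ x, (∀ ε > 0, ∃ᶠ n in atTop, ‖(T ^ n) x‖ < ε) ∧ ∃ᶠ n in atTop, 1 < ‖(T ^ n) x‖ := by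
  set V := Submodule.span ℝ S
  set Y := V.topologicalClosure
  have hYc : IsClosed (Y : Set E) := V.isClosed_topologicalClosure
  have : CompleteSpace Y := hYc.completeSpace_coe
  have hV : ∀ x ∈ V, Tendsto (fun n => (T ^ n) x) atTop (𝓝 0) := fun x hx => by
    induction hx using Submodule.span_induction with
    | mem x hx => exact hS x hx
    | zero => simp
    | add x y _ _ hx hy => simpa using hx.add hy
    | smul a x _ hx => simpa using hx.const_smul a
  have hVY : V ≤ Y := V.le_topologicalClosure
  let R : ℕ → Y →L[ℝ] E := fun n => (T ^ n).comp Y.subtypeL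
  have hRapp (n : ℕ) (y : Y) : R n y = (T ^ n) y := rfl
  -- Banach-Steinhaus: some orbit starting in `Y` is unbounded.
  obtain ⟨y, hy⟩ : ∃ y : Y, ∀ C, ∃ n, C < ‖(T ^ n) (y : E)‖ := by
    by_contra! h
    obtain ⟨C, hC⟩ := banach_steinhaus (g := R) h
    obtain ⟨x, hx, n, hn⟩ := hub C
    have h1 := (R n).le_of_opNorm_le (hC n) ⟨x, hVY (Submodule.subset_span hx)⟩
    exact absurd hn (not_lt.2 h1)
  have hyfreq (C : ℝ) : ∃ᶠ n in atTop, C < ‖(T ^ n) (y : E)‖ := by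
    rw [frequently_atTop]
    intro N
    obtain ⟨D, hD⟩ := ((finite_Iio N).image fun n => ‖(T ^ n) (y : E)‖).bddAbove
    obtain ⟨n, hn⟩ := hy (max C D)
    refine ⟨n, ?_, (le_max_left _ _).trans_lt hn⟩
    by_contra! hlt
    exact absurd (hD ⟨n, hlt, rfl⟩) (not_le.2 ((le_max_right _ _).trans_lt hn))
  have hVdense : Dense {u : Y | (u : E) ∈ V} := by
    intro u
    rw [closure_subtype]
    refine closure_mono ?_ u.2
    exact fun v hv => ⟨⟨v, hVY hv⟩, hv, rfl⟩
  let A : ℕ → Set Y := fun k => {u | ∃ n ≥ k, ‖R n u‖ < 1 / ((k : ℝ) + 1)}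
  let U : ℕ → Set Y := fun k => {u | ∃ n ≥ k, 1 < ‖R n u‖}
  have hAo (k : ℕ) : IsOpen (A k) := by
    have : A k = ⋃ n, ⋃ (_ : n ≥ k), {u | ‖R n u‖ < 1 / ((k : ℝ) + 1)} := by ext; simp [A]
    rw [this]
    exact isOpen_iUnion fun n => isOpen_iUnion fun _ =>
      isOpen_lt (R n).continuous.norm continuous_const
  have hUo (k : ℕ) : IsOpen (U k) := by
    have : U k = ⋃ n, ⋃ (_ : n ≥ k), {u | 1 < ‖R n u‖} := by ext; simp [U]
    rw [this]
    exact isOpen_iUnion fun n => isOpen_iUnion fun _ =>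
      isOpen_lt continuous_const (R n).continuous.norm
  have hAd (k : ℕ) : Dense (A k) := hVdense.mono fun u hu => by
    have h := (tendsto_zero_iff_norm_tendsto_zero.1 (hV u hu)).eventually_lt_const
      (Nat.one_div_pos_of_nat (n := k))
    obtain ⟨n, hn, hkn⟩ := (h.and (eventually_ge_atTop k)).exists
    exact ⟨n, hkn, hn⟩
  have hUd (k : ℕ) : Dense (U k) := by
    rw [← dense_closure]
    refine hVdense.mono fun u hu => ?_
    have hlim : Tendsto (fun j : ℕ => u + (1 / ((j : ℝ) + 1)) • y) atTop (𝓝 u) := by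
      simpa using (tendsto_const_nhds (x := u)).add
        ((tendsto_one_div_add_atTop_nhds_zero_nat (𝕜 := ℝ)).smul_const y)
    refine mem_closure_of_tendsto hlim (Eventually.of_forall fun j => ?_)
    have hj : (0 : ℝ) < 1 / ((j : ℝ) + 1) := Nat.one_div_pos_of_nat
    have h := (tendsto_zero_iff_norm_tendsto_zero.1 (hV u hu)).eventually_lt_const one_pos
    obtain ⟨n, hn, hun, hkn⟩ := ((hyfreq (2 / (1 / ((j : ℝ) + 1)))).and_eventually
      (h.and (eventually_ge_atTop k))).exists
    refine ⟨n, hkn, ?_⟩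
    rw [div_lt_iff₀' hj] at hn
    have h2 : ‖(1 / ((j : ℝ) + 1)) • (T ^ n) (y : E)‖ = 1 / ((j : ℝ) + 1) * ‖(T ^ n) (y : E)‖ := by
      rw [norm_smul, Real.norm_of_nonneg hj.le]
    have h3 := norm_sub_le_norm_add ((1 / ((j : ℝ) + 1)) • (T ^ n) (y : E)) ((T ^ n) (u : E))
    rw [map_add, map_smul, hRapp, hRapp, add_comm]
    linarith
  obtain ⟨u, hu⟩ := (dense_iInter_of_isOpen (f := fun k => A k ∩ U k)
    (fun k => (hAo k).inter (hUo k))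
    (fun k => (hAd k).inter_of_isOpen_left (hUd k) (hAo k))).nonempty
  rw [mem_iInter] at hu
  refine ⟨u, fun ε hε => ?_, ?_⟩
  · rw [frequently_atTop]
    intro N
    obtain ⟨k, hk⟩ := exists_nat_one_div_lt hε
    obtain ⟨n, hn, hlt⟩ := (hu (max N k)).1
    refine ⟨n, (le_max_left _ _).trans hn, hlt.trans_le (le_trans ?_ hk.le)⟩
    exact Nat.one_div_le_one_div (le_max_right _ _)
  · rw [frequently_atTop]
    exact fun N => (hu N).2

lemma iterSet_zero {X : Type*} (f : X → X) (B : Set X) : iterSet f 0 B = B := by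
  simp [iterSet]

/-- For an injective map, preimages under iterates shift the index of `iterSet`. -/
lemma preimage_iterate_iterSet {X : Type*} {f : X → X} (hinj : Function.Injective f) (n : ℕ)
    (m : ℤ) (B : Set X) : f^[n] ⁻¹' iterSet f m B = iterSet f (m - n) B := by
  unfold iterSet
  split_ifs with h1 h2 h2
  · obtain ⟨k, hk⟩ : ∃ k : ℕ, m = n + k := ⟨(m - n).toNat, by omega⟩
    have e1 : m.toNat = n + k := by omega
    have e2 : (m - n).toNat = k := by omega
    rw [e1, e2, Function.iterate_add, image_comp, preimage_image_eq _ (hinj.iterate n)]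
  · obtain ⟨k, hk⟩ : ∃ k : ℕ, (n : ℤ) = m + k := ⟨(n - m).toNat, by omega⟩
    have e1 : n = m.toNat + k := by omega
    have e2 : (-(m - n)).toNat = k := by omega
    rw [e2, e1, Function.iterate_add, preimage_comp, preimage_image_eq _ (hinj.iterate _)]
  · omega
  · have e2 : (-(m - n)).toNat = (-m).toNat + n := by omega
    rw [e2, Function.iterate_add, preimage_comp]

lemma measurableSet_iterSet {X : Type*} [MeasurableSpace X] {f : X → X} (hf : Measurable f)
    (hfim : ∀ B : Set X, MeasurableSet B → MeasurableSet (f '' B)) {B : Set X}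
    (hB : MeasurableSet B) (m : ℤ) : MeasurableSet (iterSet f m B) := by
  unfold iterSet
  split_ifs
  · induction m.toNat with
    | zero => simpa using hB
    | succ k ih =>
      rw [Function.iterate_succ', image_comp]
      exact hfim _ ih
  · exact hf.iterate _ hB

/-- The powers of the composition operator act on indicators by taking preimages. -/
lemma pow_apply_indicatorConstLp {X : Type*} [MeasurableSpace X] {μ : Measure X} {p : ℝ≥0∞}
    [Fact (1 ≤ p)] {f : X → X} (hf : Measurable f)
    (hfin : ∀ A : Set X, MeasurableSet A → μ A ≠ ∞ → μ (f ⁻¹' A) ≠ ∞)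
    (hq : Measure.QuasiMeasurePreserving f μ μ)
    (T : Lp ℝ p μ →L[ℝ] Lp ℝ p μ) (hT : ∀ φ : Lp ℝ p μ, ⇑(T φ) =ᵐ[μ] fun x => φ (f x))
    (n : ℕ) {A : Set X} (hA : MeasurableSet A) (hμA : μ A ≠ ∞) :
    ∃ h : μ (f^[n] ⁻¹' A) ≠ ∞, (T ^ n) (indicatorConstLp p hA hμA (1 : ℝ)) =
      indicatorConstLp p (hf.iterate n hA) h (1 : ℝ) := by
  induction n with
  | zero => exact ⟨hμA, rfl⟩
  | succ n ih =>
    obtain ⟨h, ih⟩ := ih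
    have e : f^[n + 1] ⁻¹' A = f ⁻¹' (f^[n] ⁻¹' A) := by
      rw [Function.iterate_succ, preimage_comp]
    refine ⟨e ▸ hfin _ (hf.iterate n hA) h, ?_⟩
    rw [pow_succ', mul_apply_eq_comp, ih]
    refine Lp.ext ((hT _).trans ?_)
    refine (hq.ae_eq_comp indicatorConstLp_coeFn).trans (EventuallyEq.trans ?_
      indicatorConstLp_coeFn.symm)
    exact Eventually.of_forall fun x => by rw [e]; rfl

/-- **Corollary 1.** Assume `f` injective. The composition operator `T_f` is Li-Yorke
chaotic if there exists a measurable set `B` of finite positive measure such that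
(i) `liminf μ(f^{-n}(B)) = 0` and
(ii) `sup { μ(f^n(B)) / μ(f^m(B)) : n ∈ ℤ, m ∈ I, n < m } = ∞`, where
`I = { m ∈ ℤ : 0 < μ(f^m(B)) < ∞ }`. -/
theorem liYorke_of_exists_set
    {X : Type*} [MeasurableSpace X] (μ : Measure X) (hX : μ Set.univ ≠ 0)
    (p : ℝ≥0∞) [Fact (1 ≤ p)] (hp : p ≠ ∞)
    (f : X → X) (hf : Measurable f)
    (hfim : ∀ B : Set X, MeasurableSet B → MeasurableSet (f '' B))
    (c : ℝ≥0∞) (hc : 0 < c)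
    (hcf : ∀ B : Set X, MeasurableSet B → c * μ B ≤ μ (f '' B))
    (hinj : Function.Injective f)
    (T : Lp ℝ p μ →L[ℝ] Lp ℝ p μ)
    (hT : ∀ φ : Lp ℝ p μ, ⇑(T φ) =ᵐ[μ] fun x => φ (f x))
    (B : Set X) (hB : MeasurableSet B) (hB0 : 0 < μ B) (hBfin : μ B < ∞)
    (hi : atTop.liminf (fun n : ℕ => μ (f^[n] ⁻¹' B)) = 0)
    (hii : (⨆ (n : ℤ) (m : ℤ)
        (_ : n < m ∧ 0 < μ (iterSet f m B) ∧ μ (iterSet f m B) < ∞),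
        μ (iterSet f n B) / μ (iterSet f m B)) = ∞) :
    LiYorkeChaotic (⇑T) := by
  have hp1 : 1 ≤ p := Fact.out
  have hp0 : p ≠ 0 := (one_pos.trans_le hp1).ne'
  have hpr : 0 < p.toReal := ENNReal.toReal_pos hp0 hp
  have hle (A : Set X) (hA : MeasurableSet A) : c * μ (f ⁻¹' A) ≤ μ A :=
    (hcf _ (hf hA)).trans (measure_mono (image_preimage_subset f A))
  have hfin (A : Set X) (hA : MeasurableSet A) (hμ : μ A ≠ ∞) : μ (f ⁻¹' A) ≠ ∞ := by
    intro h
    have := hle A hA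
    rw [h, ENNReal.mul_top hc.ne', top_le_iff] at this
    exact hμ this
  have hq : Measure.QuasiMeasurePreserving f μ μ := by
    refine ⟨hf, Measure.AbsolutelyContinuous.mk fun A hA h => ?_⟩
    rw [Measure.map_apply hf hA]
    have := hle A hA
    rw [h, nonpos_iff_eq_zero, mul_eq_zero] at this
    exact this.resolve_left hc.ne'
  have hmeas := measurableSet_iterSet hf hfim hB
  have hnorm (m : ℤ) (h : μ (iterSet f m B) ≠ ∞) (n : ℕ) :
      ‖(T ^ n) (indicatorConstLp p (hmeas m) h (1 : ℝ))‖ =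
        μ.real (iterSet f (m - n) B) ^ (1 / p.toReal) := by
    obtain ⟨h', e⟩ := pow_apply_indicatorConstLp hf hfin hq T hT n (hmeas m) h
    rw [e, norm_indicatorConstLp hp0 hp, norm_one, one_mul, preimage_iterate_iterSet hinj]
  have hB' : μ (iterSet f 0 B) ≠ ∞ := by rw [iterSet_zero]; exact hBfin.ne
  have h0 : ∀ ε > 0, ∃ᶠ n in atTop,
      ‖(T ^ n) (indicatorConstLp p (hmeas 0) hB' (1 : ℝ))‖ < ε := fun ε hε => by
    have hpos : 0 < ENNReal.ofReal (ε ^ p.toReal) :=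
      ENNReal.ofReal_pos.2 (Real.rpow_pos_of_pos hε _)
    refine (frequently_lt_of_liminf_lt (by isBoundedDefault) (hi.trans_lt hpos)).mono
      fun n hn => ?_
    rw [hnorm, ← preimage_iterate_iterSet hinj, iterSet_zero, one_div]
    refine (Real.rpow_lt_rpow measureReal_nonneg (ENNReal.toReal_lt_of_lt_ofReal hn)
      (inv_pos.2 hpr)).trans_eq ?_
    exact Real.rpow_rpow_inv hε.le hpr.ne'
  by_cases hx : Tendsto (fun n => (T ^ n) (indicatorConstLp p (hmeas 0) hB' (1 : ℝ))) atTop (𝓝 0)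
  · obtain ⟨u, hu0, hu1⟩ := exists_semiIrregular_of_unbounded T
      {y | ∃ (m : ℤ) (h : μ (iterSet f m B) ≠ ∞), y = indicatorConstLp p (hmeas m) h (1 : ℝ)}
      (by
        rintro _ ⟨m, h, rfl⟩
        rw [← tendsto_add_atTop_iff_nat m.toNat, tendsto_zero_iff_norm_tendsto_zero]
        rw [← tendsto_add_atTop_iff_nat (-m).toNat, tendsto_zero_iff_norm_tendsto_zero] at hx
        refine hx.congr fun n => ?_
        rw [hnorm, hnorm]
        congr 3
        omega)
      (by
        intro C
        have hlt : ENNReal.ofReal (max C 0 ^ p.toReal) < ∞ := ENNReal.ofReal_lt_top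
        rw [← hii] at hlt
        simp only [lt_iSup_iff] at hlt
        obtain ⟨n, m, ⟨hnm, hm0, hmt⟩, hlt⟩ := hlt
        refine ⟨_, ⟨m, hmt.ne, rfl⟩, (m - n).toNat, ?_⟩
        have hn : μ (iterSet f n B) ≠ ∞ := by
          obtain ⟨h', -⟩ :=
            pow_apply_indicatorConstLp hf hfin hq T hT (m - n).toNat (hmeas m) hmt.ne
          rw [preimage_iterate_iterSet hinj] at h'
          convert h' using 3
          omega
        rw [ENNReal.lt_div_iff_mul_lt (.inl hm0.ne') (.inl hmt.ne)] at hlt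
        have hC : 0 ≤ max C 0 := le_max_right _ _
        have key := ENNReal.toReal_strict_mono hn hlt
        rw [ENNReal.toReal_mul, ENNReal.toReal_ofReal (Real.rpow_nonneg hC _)] at key
        have key2 := Real.rpow_lt_rpow
          (mul_nonneg (Real.rpow_nonneg hC _) ENNReal.toReal_nonneg) key (inv_pos.2 hpr)
        rw [Real.mul_rpow (Real.rpow_nonneg hC _) ENNReal.toReal_nonneg,
          Real.rpow_rpow_inv hC hpr.ne'] at key2
        have e : m - ((m - n).toNat : ℤ) = n := by omega
        rw [hnorm, e, norm_indicatorConstLp hp0 hp, norm_one, one_mul, one_div]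
        refine lt_of_le_of_lt ?_ key2
        exact mul_le_mul_of_nonneg_right (le_max_left _ _)
          (Real.rpow_nonneg ENNReal.toReal_nonneg _))
    exact .of_semiIrregular T u hu0 ⟨1, one_pos, hu1⟩
  · refine .of_semiIrregular T _ h0 ?_
    rw [tendsto_zero_iff_norm_tendsto_zero, Metric.tendsto_nhds] at hx
    push Not at hx
    obtain ⟨ε, hε, hx⟩ := hx
    refine ⟨ε / 2, half_pos hε, hx.mono fun n hn => ?_⟩
    rw [dist_zero_right, norm_norm] at hn
    exact (half_lt_self hε).trans_le hn
end
end

section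
/- Let X = ℤ, 𝓑 = 𝒫(ℤ), f : i ↦ i+1, and let μ be a measure on 𝒫(ℤ) such that 0 < μ({k}) < ∞ for some k ∈ ℤ and such that there exists c > 0 with μ(f(B)) ≥ c·μ(B) for every B ⊆ ℤ. Then the composition operator T_f on L^p(ℤ,𝒫(ℤ),μ) is Li-Yorke chaotic if and only if: (a) liminf_{i→−∞} μ({i}) = 0, and (b) sup{ μ({i}) / μ({j}) : i,j ∈ ℤ, i < j, 0 < μ({j}) < ∞ } = ∞. -/
open MeasureTheory Filter Set Topology
open scoped ENNReal

noncomputable section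

section BaireCriterion

variable {E : Type*} [NormedAddCommGroup E] [NormedSpace ℝ E]

lemma ContinuousLinearMap.dist_iterate (T : E →L[ℝ] E) (n : ℕ) (x y : E) :
    dist (T^[n] x) (T^[n] y) = ‖T^[n] (x - y)‖ := by
  rw [dist_eq_norm, ← FunLike.coe_pow_eq_iterate, map_sub]

/-- The multiples of a single irregular vector form a scrambled set. -/
lemma liYorkeChaotic_of_irregular (T : E →L[ℝ] E) (x : E)
    (hinf : ∀ ε > 0, ∃ᶠ n in atTop, ‖T^[n] x‖ < ε)
    (hsup : ∃ᶠ n in atTop, 1 < ‖T^[n] x‖) : LiYorkeChaotic T := by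
  have hx : x ≠ 0 := by
    rintro rfl
    obtain ⟨n, hn⟩ := hsup.exists
    rw [← FunLike.coe_pow_eq_iterate, map_zero, norm_zero] at hn
    linarith
  have hnorm : ∀ (a b : ℝ) (n : ℕ),
      dist (T^[n] (a • x)) (T^[n] (b • x)) = |a - b| * ‖T^[n] x‖ := by
    intro a b n
    rw [T.dist_iterate, ← sub_smul, ← FunLike.coe_pow_eq_iterate, map_smul, norm_smul, Real.norm_eq_abs]
  refine ⟨(fun a : ℝ => a • x) '' univ, fun h => ?_, ?_⟩
  · exact Cardinal.not_countable_real
      (Set.countable_of_injective_of_countable_image (smul_left_injective ℝ hx).injOn h)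
  · rintro _ ⟨a, -, rfl⟩ _ ⟨b, -, rfl⟩ hab
    have hpos : 0 < |a - b| := abs_pos.2 (sub_ne_zero.2 fun h => hab (by rw [h]))
    simp only [hnorm]
    refine ⟨fun ε hε => (hinf (ε / |a - b|) (by positivity)).mono fun n hn => ?_,
      |a - b|, hpos, hsup.mono fun n hn => ?_⟩
    · rwa [lt_div_iff₀' hpos] at hn
    · exact lt_mul_of_one_lt_right hpos hn

/-- If the powers of `T` are unbounded and a dense set of orbits accumulates at `0`, then `T` is
Li-Yorke chaotic. -/
lemma liYorkeChaotic_of_dense [CompleteSpace E] (T : E →L[ℝ] E)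
    (hdense : Dense {x : E | ∀ ε > 0, ∃ᶠ n in atTop, ‖T^[n] x‖ < ε})
    (hunb : ∀ C : ℝ, 0 < C → ∃ (n : ℕ) (v : E), C * ‖v‖ < ‖T^[n] v‖) :
    LiYorkeChaotic T := by
  have hcont : ∀ n : ℕ, Continuous fun x => ‖T^[n] x‖ := fun n => (T.continuous.iterate n).norm
  have hA : ∀ᶠ x in residual E, ∀ k N : ℕ, ∃ n ≥ N, ‖T^[n] x‖ < 1 / ((k : ℝ) + 1) := by
    refine eventually_countable_forall.2 fun k => eventually_countable_forall.2 fun N => ?_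
    refine residual_of_dense_open (s := {x | ∃ n ≥ N, ‖T^[n] x‖ < 1 / ((k : ℝ) + 1)}) ?_ ?_
    · simp only [ge_iff_le, ofPred_exists, ofPred_and]
      exact isOpen_iUnion fun n => isOpen_const.inter (isOpen_lt (hcont n) continuous_const)
    · exact hdense.mono fun x (hx : ∀ ε > 0, ∃ᶠ n in atTop, ‖T^[n] x‖ < ε) =>
        frequently_atTop.1 (hx _ (by positivity)) N
  have hB : ∀ᶠ x in residual E, ∀ K : ℕ, ∃ n, (K : ℝ) < ‖T^[n] x‖ := by
    refine eventually_countable_forall.2 fun K => ?_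
    refine residual_of_dense_open (s := {x | ∃ n, (K : ℝ) < ‖T^[n] x‖}) ?_ ?_
    · simp only [ofPred_exists]
      exact isOpen_iUnion fun n => isOpen_lt continuous_const (hcont n)
    · refine Metric.dense_iff.2 fun x r hr => ?_
      obtain ⟨n, v, hv⟩ := hunb (2 * (K + 1) / r) (by positivity)
      have hv0 : 0 < ‖v‖ := by
        refine norm_pos_iff.2 ?_
        rintro rfl
        rw [← FunLike.coe_pow_eq_iterate, map_zero, norm_zero] at hv
        simp at hv
      set e : E := (r / (2 * ‖v‖)) • v with he
      have hpos : 0 < r / (2 * ‖v‖) := by positivity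
      have hen : ‖e‖ < r := by
        rw [he, norm_smul, Real.norm_of_nonneg hpos.le]
        have : r / (2 * ‖v‖) * ‖v‖ = r / 2 := by field_simp
        linarith
      have hTe : (K : ℝ) < ‖T^[n] e‖ := by
        have h1 : ‖T^[n] e‖ = r / (2 * ‖v‖) * ‖T^[n] v‖ := by
          rw [he, ← FunLike.coe_pow_eq_iterate, map_smul, norm_smul, Real.norm_of_nonneg hpos.le]
        have h2 : r / (2 * ‖v‖) * (2 * (K + 1) / r * ‖v‖) = K + 1 := by field_simp
        have h3 := mul_lt_mul_of_pos_left hv hpos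
        linarith
      have hsum : T^[n] (x + e) - T^[n] (x - e) = T^[n] e + T^[n] e := by
        rw [← FunLike.coe_pow_eq_iterate, map_add, map_sub]
        abel
      have htri := norm_sub_le (T^[n] (x + e)) (T^[n] (x - e))
      rw [hsum, ← two_smul ℝ, norm_smul, Real.norm_of_nonneg zero_le_two] at htri
      rcases lt_or_ge (K : ℝ) ‖T^[n] (x + e)‖ with h | h
      · exact ⟨x + e, by simpa using hen, n, h⟩
      · exact ⟨x - e, by simpa using hen, n, by linarith⟩
  obtain ⟨x, hxA, hxB⟩ := (dense_of_mem_residual (hA.and hB)).nonempty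
  refine liYorkeChaotic_of_irregular T x (fun ε hε => frequently_atTop.2 fun N => ?_) ?_
  · obtain ⟨k, hk⟩ := exists_nat_one_div_lt hε
    obtain ⟨n, hn, hlt⟩ := hxA k N
    exact ⟨n, hn, hlt.trans hk⟩
  · by_contra h
    rw [not_frequently] at h
    have hbdd : BddAbove (range fun n => ‖T^[n] x‖) :=
      IsBoundedUnder.bddAbove_range ⟨1, eventually_map.2 (h.mono fun n hn => not_lt.1 hn)⟩
    obtain ⟨B, hB⟩ := hbdd
    obtain ⟨K, hK⟩ := exists_nat_gt B
    obtain ⟨n, hn⟩ := hxB K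
    exact absurd (hB ⟨n, rfl⟩) (not_le.2 (hK.trans hn))

end BaireCriterion

section Shift

variable {μ : Measure ℤ} {p : ℝ≥0∞}

lemma enorm_Lp_rpow_eq_tsum [Fact (1 ≤ p)] (hp : p ≠ ∞) (φ : Lp ℝ p μ) :
    ‖φ‖ₑ ^ p.toReal = ∑' i, ‖φ i‖ₑ ^ p.toReal * μ {i} := by
  have hp0 : p ≠ 0 := (zero_lt_one.trans_le Fact.out).ne'
  have hpr : p.toReal ≠ 0 := (ENNReal.toReal_pos hp0 hp).ne'
  rw [Lp.enorm_def, eLpNorm_eq_lintegral_rpow_enorm_toReal hp0 hp, ← ENNReal.rpow_mul,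
    one_div, inv_mul_cancel₀ hpr, ENNReal.rpow_one, lintegral_countable']

lemma iterate_shift_apply {C : ℝ≥0∞} (hC : ∀ i, μ {i} ≤ C * μ {i + 1})
    [Fact (1 ≤ p)] {T : Lp ℝ p μ →L[ℝ] Lp ℝ p μ}
    (hT : ∀ φ : Lp ℝ p μ, ⇑(T φ) =ᵐ[μ] fun i => φ (i + 1)) (φ : Lp ℝ p μ) (n : ℕ) :
    ∀ i, μ {i} ≠ 0 → (T^[n] φ) i = φ (i + n) := by
  induction n with
  | zero => simp
  | succ n ih =>
    intro i hi
    have hi' : μ {i + 1} ≠ 0 := fun h => hi (by simpa [h] using hC i)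
    rw [Function.iterate_succ_apply', (ae_iff_of_countable.1 (hT _)) i hi]
    refine (ih _ hi').trans (congrArg φ ?_)
    push_cast
    ring

lemma enorm_iterate_shift_rpow {C : ℝ≥0∞} (hC : ∀ i, μ {i} ≤ C * μ {i + 1})
    [Fact (1 ≤ p)] (hp : p ≠ ∞) {T : Lp ℝ p μ →L[ℝ] Lp ℝ p μ}
    (hT : ∀ φ : Lp ℝ p μ, ⇑(T φ) =ᵐ[μ] fun i => φ (i + 1)) (φ : Lp ℝ p μ) (n : ℕ) :
    ‖T^[n] φ‖ₑ ^ p.toReal = ∑' j, ‖φ j‖ₑ ^ p.toReal * μ {j - n} := by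
  rw [enorm_Lp_rpow_eq_tsum hp,
    ← (Equiv.addRight (n : ℤ)).tsum_eq fun j => ‖φ j‖ₑ ^ p.toReal * μ {j - n}]
  refine tsum_congr fun i => ?_
  rcases eq_or_ne (μ {i}) 0 with h | h
  · simp [h]
  · simp [iterate_shift_apply hC hT φ n i h]

lemma measure_singleton_sub_le {C : ℝ≥0∞} (hC : ∀ i, μ {i} ≤ C * μ {i + 1}) (l : ℕ) (i : ℤ) :
    μ {i - l} ≤ C ^ l * μ {i} := by
  induction l with
  | zero => simp
  | succ l ih =>
    have h := hC (i - (l + 1 : ℕ))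
    rw [show i - ((l + 1 : ℕ) : ℤ) + 1 = i - l by push_cast; ring] at h
    calc _ ≤ _ := h
      _ ≤ C * (C ^ l * μ {i}) := by gcongr
      _ = _ := by ring

lemma measure_singleton_eq_zero {C : ℝ≥0∞} (hC : ∀ i, μ {i} ≤ C * μ {i + 1}) {i j : ℤ}
    (hij : i ≤ j) (hj : μ {j} = 0) : μ {i} = 0 := by
  have h := measure_singleton_sub_le hC (j - i).toNat j
  rw [Int.toNat_of_nonneg (by omega), sub_sub_cancel, hj, mul_zero] at h
  exact nonpos_iff_eq_zero.1 h

lemma dense_finite_support [Fact (1 ≤ p)] (hp : p ≠ ∞) :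
    Dense {φ : Lp ℝ p μ | ∃ F : Finset ℤ, ∀ j, μ {j} ≠ 0 → j ∉ F → φ j = 0} := by
  have hpr : 0 < p.toReal := ENNReal.toReal_pos (zero_lt_one.trans_le Fact.out).ne' hp
  refine Metric.dense_iff.2 fun φ r hr => ?_
  have hfin : ∑' i, ‖φ i‖ₑ ^ p.toReal * μ {i} ≠ ∞ := by
    rw [← enorm_Lp_rpow_eq_tsum hp]
    exact ENNReal.rpow_ne_top_of_nonneg hpr.le enorm_ne_top
  obtain ⟨F, hF⟩ := ((ENNReal.tendsto_tsum_compl_atTop_zero hfin).eventually_lt_const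
    (ENNReal.rpow_pos (ENNReal.ofReal_pos.2 hr) ENNReal.ofReal_ne_top :
      0 < ENNReal.ofReal r ^ p.toReal)).exists
  have hmem : MemLp ((F : Set ℤ).indicator φ) p μ := (Lp.memLp φ).indicator F.measurableSet
  have hco := ae_iff_of_countable.1 hmem.coeFn_toLp
  refine ⟨hmem.toLp, ?_, F, fun j hj hjF => ?_⟩
  · rw [Metric.mem_ball, dist_comm, dist_eq_norm, ← ENNReal.ofReal_lt_ofReal_iff hr,
      ofReal_norm, ← ENNReal.rpow_lt_rpow_iff hpr, enorm_Lp_rpow_eq_tsum hp]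
    refine lt_of_eq_of_lt ?_ hF
    have hsub := tsum_subtype ({x | x ∉ F} : Set ℤ) fun i => ‖φ i‖ₑ ^ p.toReal * μ {i}
    refine Eq.trans (tsum_congr fun i => ?_) hsub.symm
    rcases eq_or_ne (μ {i}) 0 with h | h
    · by_cases hi : i ∈ F <;> simp [h, hi]
    · rw [(ae_iff_of_countable.1 (Lp.coeFn_sub φ hmem.toLp)) i h, Pi.sub_apply, hco i h]
      by_cases hi : i ∈ F <;> simp [hi, hpr]
  · rw [hco j hj]
    simp [hjF]

lemma frequently_norm_iterate_shift_lt {C : ℝ≥0∞} (hC : ∀ i, μ {i} ≤ C * μ {i + 1}) (hC' : C ≠ ∞)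
    [Fact (1 ≤ p)] (hp : p ≠ ∞) {T : Lp ℝ p μ →L[ℝ] Lp ℝ p μ}
    (hT : ∀ φ : Lp ℝ p μ, ⇑(T φ) =ᵐ[μ] fun i => φ (i + 1))
    (ha : liminf (fun i : ℤ => μ {i}) atBot = 0) (φ : Lp ℝ p μ) (F : Finset ℤ)
    (hF : ∀ j, μ {j} ≠ 0 → j ∉ F → φ j = 0) (ε : ℝ) (hε : 0 < ε) :
    ∃ᶠ n in atTop, ‖T^[n] φ‖ < ε := by
  have hpr : 0 < p.toReal := ENNReal.toReal_pos (zero_lt_one.trans_le Fact.out).ne' hp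
  obtain ⟨J, hJ⟩ := F.bddAbove
  set A : ℝ≥0∞ := ∑ j ∈ F, ‖φ j‖ₑ ^ p.toReal * C ^ (J - j).toNat
  have hA : A ≠ ∞ := ENNReal.sum_ne_top.2 fun j _ => ENNReal.mul_ne_top
    (ENNReal.rpow_ne_top_of_nonneg hpr.le enorm_ne_top) (ENNReal.pow_ne_top hC')
  have hδ : 0 < ENNReal.ofReal ε ^ p.toReal :=
    ENNReal.rpow_pos (ENNReal.ofReal_pos.2 hε) ENNReal.ofReal_ne_top
  have hfreq : ∃ᶠ i : ℤ in atBot, μ {i} < ENNReal.ofReal ε ^ p.toReal / (A + 1) :=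
    frequently_lt_of_liminf_lt (h := by
      rw [ha]; exact ENNReal.div_pos hδ.ne' (by finiteness))
  refine frequently_atTop.2 fun N => ?_
  obtain ⟨t, ht, hlt⟩ := frequently_atBot.1 hfreq (J - N)
  refine ⟨(J - t).toNat, by omega, ?_⟩
  rw [← ENNReal.ofReal_lt_ofReal_iff hε, ofReal_norm, ← ENNReal.rpow_lt_rpow_iff hpr,
    enorm_iterate_shift_rpow hC hp hT, Int.toNat_of_nonneg (by omega)]
  rw [tsum_eq_sum (s := F)]
  · calc ∑ j ∈ F, ‖φ j‖ₑ ^ p.toReal * μ {j - (J - t)}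
        ≤ ∑ j ∈ F, ‖φ j‖ₑ ^ p.toReal * C ^ (J - j).toNat * μ {t} := by
          refine Finset.sum_le_sum fun j hj => ?_
          rw [mul_assoc]
          have h := measure_singleton_sub_le hC (J - j).toNat t
          have hjJ : j ≤ J := hJ hj
          rw [Int.toNat_of_nonneg (by omega), show t - (J - j) = j - (J - t) by ring] at h
          gcongr
      _ = A * μ {t} := (Finset.sum_mul _ _ _).symm
      _ ≤ (A + 1) * μ {t} := by gcongr; exact le_self_add
      _ < ENNReal.ofReal ε ^ p.toReal := by
          rwa [ENNReal.lt_div_iff_mul_lt (by simp) (by simp [hA]), mul_comm] at hlt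
  · intro j hj
    rcases eq_or_ne (μ {j}) 0 with h | h
    · simp [measure_singleton_eq_zero hC (show j - (J - t) ≤ j by omega) h]
    · simp [hF j h hj, hpr]

lemma exists_mul_norm_lt_norm_iterate_shift {C : ℝ≥0∞} (hC : ∀ i, μ {i} ≤ C * μ {i + 1})
    [Fact (1 ≤ p)] (hp : p ≠ ∞) {T : Lp ℝ p μ →L[ℝ] Lp ℝ p μ}
    (hT : ∀ φ : Lp ℝ p μ, ⇑(T φ) =ᵐ[μ] fun i => φ (i + 1))
    (hb : (⨆ (i : ℤ) (j : ℤ) (_ : i < j ∧ 0 < μ {j} ∧ μ {j} < ∞), μ {i} / μ {j}) = ∞)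
    (K : ℝ) (hK : 0 < K) : ∃ (n : ℕ) (v : Lp ℝ p μ), K * ‖v‖ < ‖T^[n] v‖ := by
  have hpr : 0 < p.toReal := ENNReal.toReal_pos (zero_lt_one.trans_le Fact.out).ne' hp
  have hlt : ENNReal.ofReal K ^ p.toReal <
      ⨆ (i : ℤ) (j : ℤ) (_ : i < j ∧ 0 < μ {j} ∧ μ {j} < ∞), μ {i} / μ {j} := by
    rw [hb]
    exact ENNReal.rpow_lt_top_of_nonneg hpr.le ENNReal.ofReal_ne_top
  simp only [lt_iSup_iff] at hlt
  obtain ⟨i, j, ⟨hij, hj0, hj⟩, hlt⟩ := hlt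
  rw [ENNReal.lt_div_iff_mul_lt (.inl hj0.ne') (.inl hj.ne)] at hlt
  set v : Lp ℝ p μ := indicatorConstLp p (measurableSet_singleton j) hj.ne 1
  have hv := ae_iff_of_countable.1
    (indicatorConstLp_coeFn (p := p) (hs := measurableSet_singleton j) (hμs := hj.ne) (c := (1 : ℝ)))
  have hTv : ∀ n : ℕ, ‖T^[n] v‖ₑ ^ p.toReal = μ {j - (n : ℤ)} := by
    intro n
    rw [enorm_iterate_shift_rpow hC hp hT, tsum_eq_single j]
    · rw [hv j hj0.ne']
      simp
    · intro l hl
      rcases eq_or_ne (μ {l}) 0 with h | h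
      · simp [measure_singleton_eq_zero hC (show l - (n : ℤ) ≤ l by omega) h]
      · rw [hv l h]
        simp [hl, hpr]
  have hv0 : ‖v‖ₑ ^ p.toReal = μ {j} := by simpa using hTv 0
  refine ⟨(j - i).toNat, v, ?_⟩
  have h := hTv (j - i).toNat
  rw [Int.toNat_of_nonneg (by omega), sub_sub_cancel] at h
  rw [← hv0, ← h, ← ENNReal.mul_rpow_of_nonneg _ _ hpr.le, ENNReal.rpow_lt_rpow_iff hpr,
    ← ofReal_norm, ← ofReal_norm, ← ENNReal.ofReal_mul hK.le] at hlt
  exact (ENNReal.ofReal_lt_ofReal_iff_of_nonneg (by positivity)).1 hlt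

lemma frequently_enorm_rpow_lt {E : Type*} [NormedAddCommGroup E] {u : ℕ → E}
    (hu : ∀ ε > 0, ∃ᶠ n in atTop, ‖u n‖ < ε) {q : ℝ} (hq : 0 < q) {δ : ℝ≥0∞} (hδ : 0 < δ) :
    ∃ᶠ n in atTop, ‖u n‖ₑ ^ q < δ := by
  have hcont : Continuous fun x : E => ‖x‖ₑ ^ q :=
    (ENNReal.continuous_rpow_const).comp continuous_enorm
  have hmem : {x : E | ‖x‖ₑ ^ q < δ} ∈ 𝓝 (0 : E) :=
    (isOpen_lt hcont continuous_const).mem_nhds (by simpa [hq] using hδ)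
  obtain ⟨ε, hε, hball⟩ := Metric.mem_nhds_iff.1 hmem
  exact (hu ε hε).mono fun n hn => hball (by simpa using hn)

lemma liminf_measure_singleton_eq_zero {C : ℝ≥0∞} (hC : ∀ i, μ {i} ≤ C * μ {i + 1})
    [Fact (1 ≤ p)] (hp : p ≠ ∞) {T : Lp ℝ p μ →L[ℝ] Lp ℝ p μ}
    (hT : ∀ φ : Lp ℝ p μ, ⇑(T φ) =ᵐ[μ] fun i => φ (i + 1)) {z : Lp ℝ p μ} (hz : z ≠ 0)
    (hinf : ∀ ε > 0, ∃ᶠ n in atTop, ‖T^[n] z‖ < ε) :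
    liminf (fun i : ℤ => μ {i}) atBot = 0 := by
  have hpr : 0 < p.toReal := ENNReal.toReal_pos (zero_lt_one.trans_le Fact.out).ne' hp
  obtain ⟨j, hzj⟩ : ∃ j, z j ≠ 0 := by
    by_contra! h
    exact hz ((Lp.eq_zero_iff_ae_eq_zero).2 (.of_forall h))
  by_contra hne
  obtain ⟨δ, hδ, hlt⟩ := exists_between (pos_iff_ne_zero.2 hne)
  obtain ⟨b, hb⟩ := eventually_atBot.1 (eventually_lt_of_lt_liminf hlt)
  have hη : 0 < ‖z j‖ₑ ^ p.toReal * δ :=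
    ENNReal.mul_pos (ENNReal.rpow_pos (by simpa using hzj) enorm_ne_top).ne' hδ.ne'
  obtain ⟨n, hn, hlt⟩ := frequently_atTop.1 (frequently_enorm_rpow_lt hinf hpr hη) (j - b).toNat
  rw [enorm_iterate_shift_rpow hC hp hT] at hlt
  refine absurd hlt (not_lt.2 (le_trans ?_ (ENNReal.le_tsum j)))
  gcongr
  exact (hb _ (by omega)).le

lemma iSup_measure_singleton_div_eq_top {C : ℝ≥0∞} (hC : ∀ i, μ {i} ≤ C * μ {i + 1})
    [Fact (1 ≤ p)] (hp : p ≠ ∞) {T : Lp ℝ p μ →L[ℝ] Lp ℝ p μ}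
    (hT : ∀ φ : Lp ℝ p μ, ⇑(T φ) =ᵐ[μ] fun i => φ (i + 1)) {z : Lp ℝ p μ}
    (hinf : ∀ ε > 0, ∃ᶠ n in atTop, ‖T^[n] z‖ < ε)
    (hsup : ∃ ε > 0, ∃ᶠ n in atTop, ε < ‖T^[n] z‖) :
    (⨆ (i : ℤ) (j : ℤ) (_ : i < j ∧ 0 < μ {j} ∧ μ {j} < ∞), μ {i} / μ {j}) = ∞ := by
  have hpr : 0 < p.toReal := ENNReal.toReal_pos (zero_lt_one.trans_le Fact.out).ne' hp
  by_contra hne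
  set K := ⨆ (i : ℤ) (j : ℤ) (_ : i < j ∧ 0 < μ {j} ∧ μ {j} < ∞), μ {i} / μ {j}
  have hle : ∀ i j, i ≤ j → μ {i} ≤ (K + 1) * μ {j} := by
    intro i j hij
    rcases hij.eq_or_lt with rfl | hij
    · exact le_mul_of_one_le_left' le_add_self
    rcases eq_or_ne (μ {j}) 0 with h0 | h0
    · simp [measure_singleton_eq_zero hC hij.le h0]
    rcases eq_or_ne (μ {j}) ∞ with ht | ht
    · simp [ht, ENNReal.mul_top]
    have hK : μ {i} / μ {j} ≤ K :=
      le_iSup_of_le i (le_iSup_of_le j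
        (le_iSup_of_le ⟨hij, pos_iff_ne_zero.2 h0, lt_top_iff_ne_top.2 ht⟩ le_rfl))
    exact (ENNReal.div_le_iff h0 ht).1 (hK.trans le_self_add)
  have hbdd : ∀ (φ : Lp ℝ p μ) (n : ℕ),
      ‖T^[n] φ‖ₑ ^ p.toReal ≤ (K + 1) * ‖φ‖ₑ ^ p.toReal := by
    intro φ n
    rw [enorm_iterate_shift_rpow hC hp hT, enorm_Lp_rpow_eq_tsum hp, ← ENNReal.tsum_mul_left]
    refine ENNReal.tsum_le_tsum fun j => ?_
    rw [mul_left_comm]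
    gcongr
    exact hle _ _ (by omega)
  obtain ⟨ε, hε, hfreq⟩ := hsup
  have hη : 0 < ENNReal.ofReal ε ^ p.toReal / (K + 1) :=
    ENNReal.div_pos (ENNReal.rpow_pos (ENNReal.ofReal_pos.2 hε) ENNReal.ofReal_ne_top).ne'
      (by finiteness)
  obtain ⟨N, hN⟩ := (frequently_enorm_rpow_lt hinf hpr hη).exists
  rw [ENNReal.lt_div_iff_mul_lt (by simp) (by simp [hne]), mul_comm] at hN
  obtain ⟨n, hn, hlt⟩ := frequently_atTop.1 hfreq N
  obtain ⟨l, rfl⟩ := Nat.exists_eq_add_of_le' hn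
  have h := (hbdd (T^[N] z) l).trans_lt hN
  rw [← Function.iterate_add_apply, ENNReal.rpow_lt_rpow_iff hpr, ← ofReal_norm,
    ENNReal.ofReal_lt_ofReal_iff hε] at h
  exact lt_asymm h hlt

end Shift

/-- **Corollary 2.** Let `X = ℤ`, `𝓑 = 𝒫(ℤ)`, `f : i ↦ i + 1`, and let `μ` be a measure
with `0 < μ({k}) < ∞` for some `k` and `μ(f(B)) ≥ c·μ(B)` for all `B` and some `c > 0`.
Then `T_f` on `L^p(ℤ, 𝒫(ℤ), μ)` is Li-Yorke chaotic if and only if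
(a) `liminf_{i → -∞} μ({i}) = 0`, and
(b) `sup { μ({i}) / μ({j}) : i < j, 0 < μ({j}) < ∞ } = ∞`. -/
theorem liYorke_shift_iff
    (μ : Measure ℤ) (p : ℝ≥0∞) [Fact (1 ≤ p)] (hp : p ≠ ∞)
    (hk : ∃ k : ℤ, 0 < μ {k} ∧ μ {k} < ∞)
    (c : ℝ≥0∞) (hc : 0 < c)
    (hcf : ∀ B : Set ℤ, c * μ B ≤ μ ((fun i : ℤ => i + 1) '' B))
    (T : Lp ℝ p μ →L[ℝ] Lp ℝ p μ)
    (hT : ∀ φ : Lp ℝ p μ, ⇑(T φ) =ᵐ[μ] fun i => φ (i + 1)) :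
    LiYorkeChaotic (⇑T) ↔
      (Filter.liminf (fun i : ℤ => μ {i}) atBot = 0 ∧
        (⨆ (i : ℤ) (j : ℤ) (_ : i < j ∧ 0 < μ {j} ∧ μ {j} < ∞),
          μ {i} / μ {j}) = ∞) := by
  obtain ⟨C, hC', hC⟩ : ∃ C : ℝ≥0∞, C ≠ ∞ ∧ ∀ i, μ {i} ≤ C * μ {i + 1} := by
    have h0 : min c 1 ≠ 0 := (lt_min hc one_pos).ne'
    have h1 : min c 1 ≠ ∞ := ne_top_of_le_ne_top ENNReal.one_ne_top (min_le_right _ _)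
    refine ⟨(min c 1)⁻¹, ENNReal.inv_ne_top.2 h0, fun i => ?_⟩
    have h := hcf {i}
    rw [image_singleton] at h
    rw [← ENNReal.mul_le_iff_le_inv h0 h1]
    exact (mul_le_mul_left (min_le_left c 1) _).trans h
  constructor
  · rintro ⟨S, hS, hpair⟩
    obtain ⟨x, hx, y, hy, hxy⟩ : S.Nontrivial := by
      rw [← not_subsingleton_iff]
      exact fun h => hS h.countable
    obtain ⟨hinf, hsup⟩ := hpair x hx y hy hxy
    simp only [T.dist_iterate] at hinf hsup
    exact ⟨liminf_measure_singleton_eq_zero hC hp hT (sub_ne_zero.2 hxy) hinf,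
      iSup_measure_singleton_div_eq_top hC hp hT hinf hsup⟩
  · rintro ⟨ha, hb⟩
    refine liYorkeChaotic_of_dense T ((dense_finite_support hp).mono ?_)
      (exists_mul_norm_lt_norm_iterate_shift hC hp hT hb)
    rintro φ ⟨F, hF⟩
    exact frequently_norm_iterate_shift_lt hC hC' hp hT ha φ F hF
end
end

section
/- Assume that μ is a finite measure and that f is injective. Then the following assertions are equivalent: (LY1) T_f is Li-Yorke chaotic; (LY2) there exists φ ∈ L^p(X,𝓑,μ) with φ ≠ 0 and liminf_{n→∞} ‖T_f^n φ‖ = 0; (LY3) there exists B ∈ 𝓑 with μ(B) > 0 and liminf_{n→∞} μ(f^{-n}(B)) = 0; (LY4) there exists B ∈ 𝓑 with μ(B) > 0 and liminf_{n→∞} μ(f^n(B)) = 0; (LY5) there exists B ∈ 𝓑 with μ(B) > 0, liminf_{n→∞} μ(f^{-n}(B)) = 0 and liminf_{n→∞} μ(f^n(B)) = 0; (LY6) there exists B ∈ 𝓑 with μ(B) > 0, liminf_{n→∞} μ(f^{-n}(B)) = 0 and limsup_{n→∞} μ(f^{-n}(B)) > 0; (LY7) T_f admits a characteristic function χ_B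 (for some B ∈ 𝓑 with μ(B) < ∞) as a semi-irregular vector. -/
open MeasureTheory Filter Set Topology
open scoped ENNReal

noncomputable section

theorem liminf_eq_zero_iff_frequently_lt {u : ℕ → ℝ≥0∞} :
    atTop.liminf u = 0 ↔ ∀ ε > 0, ∃ᶠ n in atTop, u n < ε := by
  constructor
  · intro h ε hε
    exact frequently_lt_of_liminf_lt (by isBoundedDefault) (h ▸ hε)
  · intro h
    refine le_antisymm (le_of_forall_gt fun ε hε => ?_) zero_le
    obtain ⟨δ, hδ, hδε⟩ := exists_between hε
    exact (liminf_le_of_frequently_le' ((h δ hδ).mono fun _ => le_of_lt)).trans_lt hδε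

theorem liminf_eq_zero_iff_exists_subseq {u : ℕ → ℝ≥0∞} :
    atTop.liminf u = 0 ↔ ∃ s : ℕ → ℕ, StrictMono s ∧ Tendsto (u ∘ s) atTop (𝓝 0) := by
  rw [liminf_eq_zero_iff_frequently_lt]
  constructor
  · intro h
    obtain ⟨s, hs, hus⟩ := extraction_forall_of_frequently
      (P := fun k n => u n < ((k : ℝ≥0∞))⁻¹) fun k => h _ (by simp)
    exact ⟨s, hs, tendsto_of_tendsto_of_tendsto_of_le_of_le tendsto_const_nhds
      ENNReal.tendsto_inv_nat_nhds_zero (fun _ => zero_le) fun k => (hus k).le⟩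
  · rintro ⟨s, hs, hus⟩ ε hε
    exact hs.tendsto_atTop.frequently (hus.eventually_lt_const hε).frequently

theorem liminf_eq_zero_mono {u v : ℕ → ℝ≥0∞} (h : ∀ n, u n ≤ v n) (hv : atTop.liminf v = 0) :
    atTop.liminf u = 0 :=
  le_antisymm (hv ▸ liminf_le_liminf (Eventually.of_forall h)) zero_le

theorem ENNReal.tendsto_zero_of_const_mul_le {ι : Type*} {l : Filter ι} {u v : ι → ℝ≥0∞}
    {a : ℝ≥0∞} (ha : a ≠ 0) (ha' : a ≠ ∞) (h : ∀ i, a * u i ≤ v i) (hv : Tendsto v l (𝓝 0)) :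
    Tendsto u l (𝓝 0) := by
  have h0 : Tendsto (fun i => a⁻¹ * v i) l (𝓝 0) := by
    simpa using ENNReal.Tendsto.const_mul hv (Or.inr (ENNReal.inv_ne_top.2 ha))
  refine tendsto_of_tendsto_of_tendsto_of_le_of_le tendsto_const_nhds h0
    (fun _ => zero_le) fun i => ?_
  calc u i = a⁻¹ * (a * u i) := by rw [← mul_assoc, ENNReal.inv_mul_cancel ha ha', one_mul]
    _ ≤ a⁻¹ * v i := by gcongr; exact h i

/-- The `i`-th stage of the backward saturation of `B` inside `Z`. -/
def backwardStage {X : Type*} (f : X → X) (Z B : Set X) (i : ℕ) : Set X :=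
  Z ∩ ⋃ j ∈ Finset.range i, f^[j] ⁻¹' B

theorem monotone_backwardStage {X : Type*} {f : X → X} (Z B : Set X) :
    Monotone (backwardStage f Z B) :=
  fun _ _ h => inter_subset_inter_right _
    (biUnion_subset_biUnion_left (Finset.range_mono h))

theorem iUnion_backwardStage {X : Type*} {f : X → X} {Z B : Set X} (h : Z ⊆ ⋃ j, f^[j] ⁻¹' B) :
    ⋃ i, backwardStage f Z B i = Z := by
  refine Subset.antisymm (iUnion_subset fun i => inter_subset_left) fun x hx => ?_
  obtain ⟨j, hj⟩ := mem_iUnion.1 (h hx)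
  exact mem_iUnion.2 ⟨j + 1, hx, mem_biUnion (by simp) hj⟩

section Dynamics

variable {X : Type*} [MeasurableSpace X] {μ : Measure X} {f : X → X} {c : ℝ≥0∞}

theorem measurableSet_image_iterate (hfim : ∀ B : Set X, MeasurableSet B → MeasurableSet (f '' B))
    (n : ℕ) {B : Set X} (hB : MeasurableSet B) : MeasurableSet (f^[n] '' B) := by
  induction n with
  | zero => simpa using hB
  | succ n ih => rw [Function.iterate_succ', image_comp]; exact hfim _ ih

theorem pow_mul_measure_le_image_iterate
    (hfim : ∀ B : Set X, MeasurableSet B → MeasurableSet (f '' B))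
    (hcf : ∀ B : Set X, MeasurableSet B → c * μ B ≤ μ (f '' B))
    (n : ℕ) {B : Set X} (hB : MeasurableSet B) : c ^ n * μ B ≤ μ (f^[n] '' B) := by
  induction n with
  | zero => simp
  | succ n ih =>
    rw [Function.iterate_succ', image_comp, pow_succ', mul_assoc]
    exact (mul_le_mul_right ih c).trans (hcf _ (measurableSet_image_iterate hfim n hB))

theorem pow_mul_measure_preimage_iterate_le (hf : Measurable f)
    (hfim : ∀ B : Set X, MeasurableSet B → MeasurableSet (f '' B))
    (hcf : ∀ B : Set X, MeasurableSet B → c * μ B ≤ μ (f '' B))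
    (n : ℕ) {B : Set X} (hB : MeasurableSet B) : c ^ n * μ (f^[n] ⁻¹' B) ≤ μ B :=
  (pow_mul_measure_le_image_iterate hfim hcf n (hf.iterate n hB)).trans
    (measure_mono (image_preimage_subset _ _))

theorem measure_preimage_iterate_eq_zero (hf : Measurable f)
    (hfim : ∀ B : Set X, MeasurableSet B → MeasurableSet (f '' B))
    (hcf : ∀ B : Set X, MeasurableSet B → c * μ B ≤ μ (f '' B)) (hc : c ≠ 0)
    (n : ℕ) {B : Set X} (hB : MeasurableSet B) (h : μ B = 0) : μ (f^[n] ⁻¹' B) = 0 := by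
  have := pow_mul_measure_preimage_iterate_le hf hfim hcf n hB
  rw [h, nonpos_iff_eq_zero, mul_eq_zero] at this
  exact this.resolve_left (pow_ne_zero _ hc)

theorem measurableSet_backwardStage (hf : Measurable f) {Z B : Set X} (hZ : MeasurableSet Z)
    (hB : MeasurableSet B) (i : ℕ) : MeasurableSet (backwardStage f Z B i) :=
  hZ.inter (Finset.measurableSet_biUnion _ fun j _ => hf.iterate j hB)

theorem tendsto_measure_backwardStage {G : ℕ → Set X → Set X}
    (hGmono : ∀ n, Monotone (G n))
    (hGunion : ∀ n (s : ℕ → Set X) (t : Finset ℕ), G n (⋃ j ∈ t, s j) = ⋃ j ∈ t, G n (s j))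
    (hc : c ≠ 0) (hc' : c ≠ ∞) (Z : Set X) {B : Set X}
    (hG : ∀ n j, c ^ j * μ (G n (f^[j] ⁻¹' B)) ≤ μ (G n B))
    {s : ℕ → ℕ} (hs : Tendsto (fun k => μ (G (s k) B)) atTop (𝓝 0)) (i : ℕ) :
    Tendsto (fun k => μ (G (s k) (backwardStage f Z B i))) atTop (𝓝 0) := by
  have hsum : Tendsto (fun k => ∑ j ∈ Finset.range i, μ (G (s k) (f^[j] ⁻¹' B))) atTop (𝓝 0) := by
    simpa using tendsto_finsetSum (Finset.range i) fun j _ =>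
      ENNReal.tendsto_zero_of_const_mul_le (pow_ne_zero j hc) (ENNReal.pow_ne_top hc')
        (fun k => hG (s k) j) hs
  refine tendsto_of_tendsto_of_tendsto_of_le_of_le tendsto_const_nhds hsum
    (fun _ => zero_le) fun k => ?_
  refine (measure_mono (hGmono _ inter_subset_right)).trans ?_
  rw [hGunion]
  exact measure_biUnion_finset_le _ _

/-- Either there is a wandering set of positive measure, or the backward saturation of `B`
contains a completely invariant set of positive measure. -/
theorem exists_wandering_or_invariant [IsFiniteMeasure μ] (hf : Measurable f)
    (hnull : ∀ n (A : Set X), MeasurableSet A → μ A = 0 → μ (f^[n] ⁻¹' A) = 0)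
    {B : Set X} (hB : MeasurableSet B) (hB0 : 0 < μ B) :
    (∃ W, MeasurableSet W ∧ 0 < μ W ∧ ∀ n > 0, ∀ x ∈ W, f^[n] x ∉ W) ∨
    (∃ Z, MeasurableSet Z ∧ 0 < μ Z ∧ f ⁻¹' Z = Z ∧ Z ⊆ ⋃ j, f^[j] ⁻¹' B) := by
  set Y := ⋃ j, f^[j] ⁻¹' B
  have hYm : MeasurableSet Y := MeasurableSet.iUnion fun j => hf.iterate j hB
  have hback : ∀ n x, f^[n] x ∈ Y → x ∈ Y := by
    intro n x hx
    obtain ⟨j, hj⟩ := mem_iUnion.1 hx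
    exact mem_iUnion.2 ⟨j + n, by rwa [mem_preimage, Function.iterate_add_apply]⟩
  have hBY : B ⊆ Y := fun x hx => mem_iUnion.2 ⟨0, hx⟩
  have hWm : MeasurableSet (Y \ f ⁻¹' Y) := hYm.diff (hf hYm)
  by_cases hW : μ (Y \ f ⁻¹' Y) = 0
  · right
    refine ⟨⋂ n, f^[n] ⁻¹' Y, MeasurableSet.iInter fun n => hf.iterate n hYm, ?_, ?_,
      iInter_subset_of_subset 0 subset_rfl⟩
    · have hsub : Y \ (⋂ n, f^[n] ⁻¹' Y) ⊆ ⋃ n, f^[n] ⁻¹' (Y \ f ⁻¹' Y) := by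
        rintro x ⟨hxY, hx⟩
        by_contra hcon
        refine hx (mem_iInter.2 fun n => ?_)
        induction n with
        | zero => exact hxY
        | succ n ih =>
          by_contra h
          refine hcon (mem_iUnion.2 ⟨n, ih, fun h' => h ?_⟩)
          rwa [mem_preimage, Function.iterate_succ_apply']
      have h0 : μ (Y \ (⋂ n, f^[n] ⁻¹' Y)) = 0 :=
        measure_mono_null hsub (measure_iUnion_null fun n => hnull n _ hWm hW)
      refine (hB0.trans_le (measure_mono hBY)).trans_le ?_
      have := measure_le_inter_add_sdiff μ Y (⋂ n, f^[n] ⁻¹' Y)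
      rw [h0, add_zero] at this
      exact this.trans (measure_mono inter_subset_right)
    · ext x
      simp only [mem_preimage, mem_iInter, ← Function.iterate_succ_apply]
      exact ⟨fun h n => by
        cases n with
        | zero => exact hback 1 x (h 0)
        | succ n => exact h n, fun h n => h (n + 1)⟩
  · refine Or.inl ⟨_, hWm, pos_iff_ne_zero.2 hW, fun n hn x hx hx' => hx.2 ?_⟩
    obtain ⟨m, rfl⟩ := Nat.exists_eq_succ_of_ne_zero hn.ne'
    exact hback m (f x) (by simpa using hx'.1)

theorem tendsto_measure_preimage_of_wandering [IsFiniteMeasure μ] (hf : Measurable f)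
    {W : Set X} (hW : MeasurableSet W) (hwand : ∀ n > 0, ∀ x ∈ W, f^[n] x ∉ W) :
    Tendsto (fun n => μ (f^[n] ⁻¹' W)) atTop (𝓝 0) := by
  have key : ∀ i j, i < j → Disjoint (f^[i] ⁻¹' W) (f^[j] ⁻¹' W) := by
    intro i j hij
    rw [Set.disjoint_left]
    intro x hi hj
    refine hwand (j - i) (by omega) _ hi ?_
    rwa [← Function.iterate_add_apply, Nat.sub_add_cancel hij.le]
  refine ENNReal.tendsto_atTop_zero_of_tsum_ne_top ?_
  rw [← measure_iUnion ?_ fun n => hf.iterate n hW]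
  · exact measure_ne_top _ _
  · intro i j hij
    rcases hij.lt_or_gt with h | h
    exacts [key _ _ h, (key _ _ h).symm]

theorem tendsto_measure_image_of_wandering [IsFiniteMeasure μ]
    (hfim : ∀ B : Set X, MeasurableSet B → MeasurableSet (f '' B)) (hinj : Function.Injective f)
    {W : Set X} (hW : MeasurableSet W) (hwand : ∀ n > 0, ∀ x ∈ W, f^[n] x ∉ W) :
    Tendsto (fun n => μ (f^[n] '' W)) atTop (𝓝 0) := by
  have key : ∀ i j, i < j → Disjoint (f^[i] '' W) (f^[j] '' W) := by
    intro i j hij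
    rw [Set.disjoint_left]
    rintro _ ⟨x, hx, rfl⟩ ⟨y, hy, hxy⟩
    refine hwand (j - i) (by omega) y hy ?_
    rw [← Nat.add_sub_of_le hij.le, Function.iterate_add_apply] at hxy
    rwa [hinj.iterate i hxy]
  refine ENNReal.tendsto_atTop_zero_of_tsum_ne_top ?_
  rw [← measure_iUnion ?_ fun n => measurableSet_image_iterate hfim n hW]
  · exact measure_ne_top _ _
  · intro i j hij
    rcases hij.lt_or_gt with h | h
    exacts [key _ _ h, (key _ _ h).symm]

/-- If an exhaustion `Y` of `Z` is asymptotically negligible under the set maps `G n` along a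
subsequence, then some subset of `Z` of positive measure is asymptotically negligible under the
reverse set maps `H n`. -/
theorem exists_subset_liminf_eq_zero [IsFiniteMeasure μ] {G H : ℕ → Set X → Set X} {Z : Set X}
    (hZ : MeasurableSet Z) (hZ0 : 0 < μ Z) {Y : ℕ → Set X} (hY : ∀ i, MeasurableSet (Y i))
    (hYmono : Monotone Y) (hYZ : ⋃ i, Y i = Z)
    (hGm : ∀ n i, MeasurableSet (G n (Y i)))
    (hGH : ∀ n i, ∀ C ⊆ Z, Disjoint C (G n (Y i)) → H n C ⊆ Z \ Y i)
    {s : ℕ → ℕ} (hs : StrictMono s)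
    (hG : ∀ i, Tendsto (fun k => μ (G (s k) (Y i))) atTop (𝓝 0)) :
    ∃ C ⊆ Z, MeasurableSet C ∧ 0 < μ C ∧ atTop.liminf (fun n => μ (H n C)) = 0 := by
  obtain ⟨η, hη0, hηsum⟩ := ENNReal.exists_pos_sum_of_countable' hZ0.ne' ℕ
  have hdiff : Tendsto (fun i => μ (Z \ Y i)) atTop (𝓝 0) := by
    have := tendsto_measure_iInter_atTop (μ := μ) (s := fun i => Z \ Y i)
      (fun i => (hZ.diff (hY i)).nullMeasurableSet)
      (fun i j h => sdiff_subset_sdiff_right (hYmono h)) ⟨0, measure_ne_top _ _⟩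
    rwa [← sdiff_iUnion, hYZ, sdiff_self, measure_empty] at this
  choose i hi using fun j => (hdiff.eventually_lt_const (hη0 j)).exists
  obtain ⟨k, hk, hkη⟩ := extraction_forall_of_eventually fun j =>
    (hG (i j)).eventually_lt_const (hη0 j)
  set U := ⋃ j, G (s (k j)) (Y (i j))
  have hUm : MeasurableSet U := MeasurableSet.iUnion fun j => hGm _ _
  have hUlt : μ U < μ Z :=
    ((measure_iUnion_le _).trans (ENNReal.tsum_le_tsum fun j => (hkη j).le)).trans_lt hηsum
  refine ⟨Z \ U, sdiff_subset, hZ.diff hUm, ?_, ?_⟩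
  · exact (tsub_pos_of_lt hUlt).trans_le le_measure_sdiff
  · refine liminf_eq_zero_iff_exists_subseq.2 ⟨s ∘ k, hs.comp hk, ?_⟩
    refine tendsto_of_tendsto_of_tendsto_of_le_of_le tendsto_const_nhds
      (ENNReal.tendsto_atTop_zero_of_tsum_ne_top (hηsum.trans_le le_top).ne)
      (fun _ => zero_le) fun j => ?_
    refine (measure_mono (hGH _ (i j) _ sdiff_subset ?_)).trans (hi j).le
    exact disjoint_sdiff_left.mono_right (subset_iUnion (fun j => G (s (k j)) (Y (i j))) j)

/-- A sparse union of large pieces of the forward images of `B` has preimages whose measures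
oscillate. -/
theorem exists_liminf_preimage_eq_zero_limsup_pos [IsFiniteMeasure μ] (hf : Measurable f)
    (hfim : ∀ B : Set X, MeasurableSet B → MeasurableSet (f '' B))
    (hcf : ∀ B : Set X, MeasurableSet B → c * μ B ≤ μ (f '' B)) (hc : c ≠ 0) (hc1 : c ≤ 1)
    (hinj : Function.Injective f)
    {B : Set X} (hB : MeasurableSet B) (hB0 : 0 < μ B)
    (hBim : atTop.liminf (fun n => μ (f^[n] '' B)) = 0)
    {Y : ℕ → Set X} (hY : ∀ i, MeasurableSet (Y i)) (hYmono : Monotone Y)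
    (hBY : ∀ n, f^[n] '' B ⊆ ⋃ i, Y i) {s : ℕ → ℕ} (hs : StrictMono s)
    (hYs : ∀ i, Tendsto (fun k => μ (f^[s k] ⁻¹' Y i)) atTop (𝓝 0)) :
    ∃ D, MeasurableSet D ∧ 0 < μ D ∧ atTop.liminf (fun n => μ (f^[n] ⁻¹' D)) = 0 ∧
      0 < atTop.limsup (fun n => μ (f^[n] ⁻¹' D)) := by
  have hhalf : μ B / 2 < μ B := ENNReal.half_lt_self hB0.ne' (measure_ne_top _ _)
  have hlarge : ∀ m, ∃ i, μ B / 2 < μ (B ∩ f^[m] ⁻¹' Y i) := by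
    intro m
    have h := tendsto_measure_iUnion_atTop (μ := μ) (s := fun i => B ∩ f^[m] ⁻¹' Y i)
      (fun i j h => inter_subset_inter_right _ (preimage_mono (hYmono h)))
    rw [← inter_iUnion, ← preimage_iUnion,
      inter_eq_left.2 (image_subset_iff.1 (hBY m))] at h
    exact (h.eventually_const_lt hhalf).exists
  choose i hi using hlarge
  set D : ℕ → Set X := fun m => f^[m] '' B ∩ Y (i m) with hD
  have hDm : ∀ m, MeasurableSet (D m) := fun m =>
    (measurableSet_image_iterate hfim m hB).inter (hY _)
  have hpre : ∀ m, μ B / 2 < μ (f^[m] ⁻¹' D m) := by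
    intro m
    rw [hD, preimage_inter, preimage_image_eq _ (hinj.iterate m)]
    exact hi m
  have hfin : ∀ m, Tendsto (fun k => μ (f^[s k] ⁻¹' ⋃ l ∈ Finset.range (m + 1), D l))
      atTop (𝓝 0) := by
    intro m
    have hsum : Tendsto (fun k => ∑ l ∈ Finset.range (m + 1), μ (f^[s k] ⁻¹' Y (i l)))
        atTop (𝓝 0) := by
      simpa using tendsto_finsetSum (Finset.range (m + 1)) fun l _ => hYs (i l)
    refine tendsto_of_tendsto_of_tendsto_of_le_of_le tendsto_const_nhds hsum
      (fun _ => zero_le) fun k => ?_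
    simp only [preimage_iUnion]
    refine (measure_biUnion_finset_le _ _).trans (Finset.sum_le_sum fun l _ => ?_)
    exact measure_mono (preimage_mono inter_subset_right)
  obtain ⟨k, hk, hkm⟩ := extraction_forall_of_eventually
    (P := fun m k => μ (f^[s k] ⁻¹' ⋃ l ∈ Finset.range (m + 1), D l) < (2⁻¹ : ℝ≥0∞) ^ m)
    fun m => (hfin m).eventually_lt_const (ENNReal.pow_pos (by simp) m)
  set N := s ∘ k
  have hNmono : StrictMono N := hs.comp hk
  have hnext : ∀ m, ∃ m' > m, μ (f^[m'] '' B) < c ^ N m * (2⁻¹ : ℝ≥0∞) ^ m := by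
    intro m
    have h := liminf_eq_zero_iff_frequently_lt.1 hBim (c ^ N m * (2⁻¹ : ℝ≥0∞) ^ m)
      (ENNReal.mul_pos (pow_ne_zero _ hc) (pow_ne_zero _ (by simp)))
    obtain ⟨m', h1, h2⟩ := (h.and_eventually (eventually_gt_atTop m)).exists
    exact ⟨m', h2, h1⟩
  choose g hg hgB using hnext
  set a : ℕ → ℕ := fun j => g^[j] 0
  have ha_succ : ∀ j, a (j + 1) = g (a j) := fun j => Function.iterate_succ_apply' g j 0
  have hamono : StrictMono a := strictMono_nat_of_lt_succ fun j => by
    rw [ha_succ]; exact hg _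
  have hctop : c ≠ ∞ := (hc1.trans_lt ENNReal.one_lt_top).ne
  set E := ⋃ j, D (a j)
  have hEm : MeasurableSet E := MeasurableSet.iUnion fun j => hDm _
  have htail : ∀ j l, μ (f^[N (a j)] ⁻¹' D (a (l + j + 1))) ≤ (2⁻¹ : ℝ≥0∞) ^ (l + j) := by
    intro j l
    have h1 := pow_mul_measure_preimage_iterate_le hf hfim hcf (N (a j)) (hDm (a (l + j + 1)))
    have h2 : μ (D (a (l + j + 1))) ≤ c ^ N (a j) * (2⁻¹ : ℝ≥0∞) ^ (l + j) := by
      refine (measure_mono inter_subset_left).trans ?_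
      rw [ha_succ]
      refine (hgB _).le.trans (mul_le_mul' ?_ ?_)
      · exact pow_le_pow_right_of_le_one' hc1 (hNmono.monotone (hamono.monotone (by omega)))
      · exact pow_le_pow_right_of_le_one' (by simp) hamono.le_apply
    exact (ENNReal.mul_le_mul_iff_right (pow_ne_zero _ hc) (ENNReal.pow_ne_top hctop)).1
      (h1.trans h2)
  have hbound : ∀ j, μ (f^[N (a j)] ⁻¹' E) ≤ (2⁻¹ : ℝ≥0∞) ^ j + 2 * (2⁻¹ : ℝ≥0∞) ^ j := by
    intro j
    have hsub : f^[N (a j)] ⁻¹' E ⊆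
        (f^[N (a j)] ⁻¹' ⋃ l ∈ Finset.range (a j + 1), D l) ∪
          ⋃ l, f^[N (a j)] ⁻¹' D (a (l + j + 1)) := by
      intro x hx
      obtain ⟨l, hl⟩ := mem_iUnion.1 hx
      rcases le_or_gt l j with h | h
      · exact Or.inl (mem_biUnion (x := a l)
          (by simpa [Nat.lt_succ_iff] using hamono.monotone h) hl)
      · refine Or.inr (mem_iUnion.2 ⟨l - j - 1, ?_⟩)
        rwa [show l - j - 1 + j + 1 = l by omega]
    refine (measure_mono hsub).trans ((measure_union_le _ _).trans (add_le_add ?_ ?_))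
    · exact (hkm (a j)).le.trans (pow_le_pow_right_of_le_one' (by simp) hamono.le_apply)
    · refine (measure_iUnion_le _).trans ((ENNReal.tsum_le_tsum (htail j)).trans ?_)
      simp only [pow_add]
      rw [ENNReal.tsum_mul_right, ENNReal.tsum_geometric_two]
  have hElarge : ∀ j, μ B / 2 < μ (f^[a j] ⁻¹' E) := fun j =>
    (hpre _).trans_le (measure_mono (preimage_mono (subset_iUnion (fun j => D (a j)) j)))
  have hB2 : 0 < μ B / 2 := ENNReal.half_pos hB0.ne'
  refine ⟨E, hEm, pos_iff_ne_zero.2 fun h => ?_, ?_, ?_⟩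
  · have := measure_preimage_iterate_eq_zero hf hfim hcf hc (a 0) hEm h
    exact (hB2.trans (hElarge 0)).ne' this
  · refine liminf_eq_zero_iff_exists_subseq.2 ⟨N ∘ a, hNmono.comp hamono, ?_⟩
    have hpow : Tendsto (fun j : ℕ => (2⁻¹ : ℝ≥0∞) ^ j) atTop (𝓝 0) :=
      ENNReal.tendsto_pow_atTop_nhds_zero_of_lt_one (by simp)
    have hlim : Tendsto (fun j : ℕ => (2⁻¹ : ℝ≥0∞) ^ j + 2 * (2⁻¹ : ℝ≥0∞) ^ j) atTop (𝓝 0) := by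
      simpa using hpow.add (ENNReal.Tendsto.const_mul hpow (Or.inr (by simp)))
    exact tendsto_of_tendsto_of_tendsto_of_le_of_le tendsto_const_nhds hlim
      (fun _ => zero_le) hbound
  · refine hB2.trans_le (le_limsup_of_frequently_le' ?_)
    exact hamono.tendsto_atTop.frequently (Frequently.of_forall fun j => (hElarge j).le)

end Dynamics

section Equivalence

variable {X : Type*} [MeasurableSpace X] {μ : Measure X} {f : X → X} {c : ℝ≥0∞}

/-- A wandering set of positive measure yields a set whose preimages have oscillating measures. -/
theorem exists_of_wandering [IsFiniteMeasure μ] (hf : Measurable f)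
    (hfim : ∀ B : Set X, MeasurableSet B → MeasurableSet (f '' B))
    (hcf : ∀ B : Set X, MeasurableSet B → c * μ B ≤ μ (f '' B)) (hc : c ≠ 0) (hc1 : c ≤ 1)
    (hinj : Function.Injective f) {W : Set X} (hW : MeasurableSet W) (hW0 : 0 < μ W)
    (hwand : ∀ n > 0, ∀ x ∈ W, f^[n] x ∉ W) :
    ∃ D, MeasurableSet D ∧ 0 < μ D ∧ atTop.liminf (fun n => μ (f^[n] ⁻¹' D)) = 0 ∧
      0 < atTop.limsup (fun n => μ (f^[n] ⁻¹' D)) := by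
  have hpre := tendsto_measure_preimage_of_wandering (μ := μ) hf hW hwand
  have hshift : ∀ j, Tendsto (fun n => μ (f^[n] ⁻¹' (f^[j] '' W))) atTop (𝓝 0) := by
    intro j
    rw [← tendsto_add_atTop_iff_nat j]
    refine hpre.congr fun n => ?_
    rw [add_comm n j, Function.iterate_add, preimage_comp,
      preimage_image_eq _ (hinj.iterate j)]
  refine exists_liminf_preimage_eq_zero_limsup_pos hf hfim hcf hc hc1 hinj hW hW0
    (tendsto_measure_image_of_wandering hfim hinj hW hwand).liminf_eq
    (Y := fun i => ⋃ j ∈ Finset.range i, f^[j] '' W)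
    (fun i => Finset.measurableSet_biUnion _ fun j _ => measurableSet_image_iterate hfim j hW)
    (fun i i' h => biUnion_subset_biUnion_left (Finset.range_mono h)) (fun n => ?_)
    strictMono_id fun i => ?_
  · exact subset_iUnion_of_subset (n + 1)
      (subset_biUnion_of_mem (u := fun j => f^[j] '' W) (by simp))
  · have hsum : Tendsto (fun k => ∑ j ∈ Finset.range i, μ (f^[k] ⁻¹' (f^[j] '' W)))
        atTop (𝓝 0) := by
      simpa using tendsto_finsetSum (Finset.range i) fun j _ => hshift j
    refine tendsto_of_tendsto_of_tendsto_of_le_of_le tendsto_const_nhds hsum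
      (fun _ => zero_le) fun k => ?_
    simp only [preimage_iUnion, id_eq]
    exact measure_biUnion_finset_le _ _

theorem tendsto_measure_preimage_backwardStage (hf : Measurable f)
    (hfim : ∀ B : Set X, MeasurableSet B → MeasurableSet (f '' B))
    (hcf : ∀ B : Set X, MeasurableSet B → c * μ B ≤ μ (f '' B)) (hc : c ≠ 0) (hc1 : c ≤ 1)
    (Z : Set X) {B : Set X} (hB : MeasurableSet B) {s : ℕ → ℕ}
    (hs : Tendsto (fun k => μ (f^[s k] ⁻¹' B)) atTop (𝓝 0)) (i : ℕ) :
    Tendsto (fun k => μ (f^[s k] ⁻¹' backwardStage f Z B i)) atTop (𝓝 0) := by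
  refine tendsto_measure_backwardStage (G := fun n A => f^[n] ⁻¹' A) (fun n => monotone_preimage)
    (fun n A t => by simp only [preimage_iUnion]) hc (hc1.trans_lt ENNReal.one_lt_top).ne Z
    (fun n j => ?_) hs i
  have := pow_mul_measure_preimage_iterate_le hf hfim hcf j (hf.iterate n hB)
  rwa [← preimage_comp, ← Function.iterate_add, add_comm, Function.iterate_add,
    preimage_comp] at this

theorem tendsto_measure_image_backwardStage (hf : Measurable f)
    (hfim : ∀ B : Set X, MeasurableSet B → MeasurableSet (f '' B))
    (hcf : ∀ B : Set X, MeasurableSet B → c * μ B ≤ μ (f '' B)) (hc : c ≠ 0) (hc1 : c ≤ 1)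
    (Z : Set X) {B : Set X} (hB : MeasurableSet B) {s : ℕ → ℕ}
    (hs : Tendsto (fun k => μ (f^[s k] '' B)) atTop (𝓝 0)) (i : ℕ) :
    Tendsto (fun k => μ (f^[s k] '' backwardStage f Z B i)) atTop (𝓝 0) := by
  refine tendsto_measure_backwardStage (G := fun n A => f^[n] '' A) (fun n => monotone_image)
    (fun n A t => by simp only [image_iUnion]) hc (hc1.trans_lt ENNReal.one_lt_top).ne Z
    (fun n j => ?_) hs i
  refine (pow_mul_measure_le_image_iterate hfim hcf j
    (measurableSet_image_iterate hfim n (hf.iterate j hB))).trans (measure_mono ?_)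
  rw [← image_comp, ← Function.iterate_add, add_comm, Function.iterate_add, image_comp]
  exact image_mono (image_preimage_subset _ _)

theorem mem_iff_iterate_mem {X : Type*} {f : X → X} {Z : Set X} (hZ : f ⁻¹' Z = Z) (n : ℕ)
    (x : X) : f^[n] x ∈ Z ↔ x ∈ Z := by
  induction n generalizing x with
  | zero => rfl
  | succ n ih => rw [Function.iterate_succ_apply, ih, ← mem_preimage, hZ]

/-- If the preimages of `B` are negligible along a subsequence, then either there is a wandering
set of positive measure, or a completely invariant set `Z` exhausted by stages of the backward
saturation of `B` contains a set of positive measure whose images are negligible along a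
subsequence. -/
theorem exists_wandering_or_liminf_image [IsFiniteMeasure μ] (hf : Measurable f)
    (hfim : ∀ B : Set X, MeasurableSet B → MeasurableSet (f '' B))
    (hcf : ∀ B : Set X, MeasurableSet B → c * μ B ≤ μ (f '' B)) (hc : c ≠ 0) (hc1 : c ≤ 1)
    {B : Set X} (hB : MeasurableSet B) (hB0 : 0 < μ B) {s : ℕ → ℕ} (hs : StrictMono s)
    (hBs : Tendsto (fun k => μ (f^[s k] ⁻¹' B)) atTop (𝓝 0)) :
    (∃ W, MeasurableSet W ∧ 0 < μ W ∧ ∀ n > 0, ∀ x ∈ W, f^[n] x ∉ W) ∨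
    (∃ Z, MeasurableSet Z ∧ f ⁻¹' Z = Z ∧ Z ⊆ ⋃ j, f^[j] ⁻¹' B ∧
      ∃ C ⊆ Z, MeasurableSet C ∧ 0 < μ C ∧ atTop.liminf (fun n => μ (f^[n] '' C)) = 0) := by
  refine (exists_wandering_or_invariant hf
    (fun n A => measure_preimage_iterate_eq_zero hf hfim hcf hc n) hB hB0).imp_right ?_
  rintro ⟨Z, hZ, hZ0, hfZ, hZB⟩
  refine ⟨Z, hZ, hfZ, hZB, exists_subset_liminf_eq_zero (G := fun n A => f^[n] ⁻¹' A)
    hZ hZ0 (measurableSet_backwardStage hf hZ hB) (monotone_backwardStage Z B)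
    (iUnion_backwardStage hZB)
    (fun n i => hf.iterate n (measurableSet_backwardStage hf hZ hB i)) ?_ hs
    (tendsto_measure_preimage_backwardStage hf hfim hcf hc hc1 Z hB hBs)⟩
  rintro n i C hCZ hdisj _ ⟨x, hx, rfl⟩
  exact ⟨(mem_iff_iterate_mem hfZ n x).2 (hCZ hx), fun h => hdisj.notMem_of_mem_left hx h⟩

/-- If the images of `B` are negligible along a subsequence, then so are the preimages of some set
of positive measure. -/
theorem exists_liminf_preimage_of_liminf_image [IsFiniteMeasure μ] (hf : Measurable f)
    (hfim : ∀ B : Set X, MeasurableSet B → MeasurableSet (f '' B))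
    (hcf : ∀ B : Set X, MeasurableSet B → c * μ B ≤ μ (f '' B)) (hc : c ≠ 0) (hc1 : c ≤ 1)
    {B : Set X} (hB : MeasurableSet B) (hB0 : 0 < μ B)
    (hBim : atTop.liminf (fun n => μ (f^[n] '' B)) = 0) :
    ∃ C, MeasurableSet C ∧ 0 < μ C ∧ atTop.liminf (fun n => μ (f^[n] ⁻¹' C)) = 0 := by
  obtain ⟨s, hs, hBs⟩ := liminf_eq_zero_iff_exists_subseq.1 hBim
  obtain ⟨W, hW, hW0, hwand⟩ | ⟨Z, hZ, hZ0, hfZ, hZB⟩ := exists_wandering_or_invariant hf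
    (fun n A => measure_preimage_iterate_eq_zero hf hfim hcf hc n) hB hB0
  · exact ⟨W, hW, hW0, (tendsto_measure_preimage_of_wandering hf hW hwand).liminf_eq⟩
  obtain ⟨C, -, hC⟩ := exists_subset_liminf_eq_zero (G := fun n A => f^[n] '' A)
    (H := fun n A => f^[n] ⁻¹' A) hZ hZ0 (measurableSet_backwardStage hf hZ hB)
    (monotone_backwardStage Z B) (iUnion_backwardStage hZB)
    (fun n i => measurableSet_image_iterate hfim n (measurableSet_backwardStage hf hZ hB i))
    (fun n i C hCZ hdisj x hx => ⟨(mem_iff_iterate_mem hfZ n x).1 (hCZ hx),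
      fun h => hdisj.notMem_of_mem_left hx (mem_image_of_mem _ h)⟩) hs
    (tendsto_measure_image_backwardStage hf hfim hcf hc hc1 Z hB hBs)
  exact ⟨C, hC⟩

/-- If the preimages of `B` are negligible along a subsequence, then some set of positive measure
has both its preimages and its images negligible along subsequences. -/
theorem exists_liminf_preimage_and_image [IsFiniteMeasure μ] (hf : Measurable f)
    (hfim : ∀ B : Set X, MeasurableSet B → MeasurableSet (f '' B))
    (hcf : ∀ B : Set X, MeasurableSet B → c * μ B ≤ μ (f '' B)) (hc : c ≠ 0) (hc1 : c ≤ 1)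
    (hinj : Function.Injective f) {B : Set X} (hB : MeasurableSet B) (hB0 : 0 < μ B)
    (hBpre : atTop.liminf (fun n => μ (f^[n] ⁻¹' B)) = 0) :
    ∃ C, MeasurableSet C ∧ 0 < μ C ∧ atTop.liminf (fun n => μ (f^[n] ⁻¹' C)) = 0 ∧
      atTop.liminf (fun n => μ (f^[n] '' C)) = 0 := by
  obtain ⟨s, hs, hBs⟩ := liminf_eq_zero_iff_exists_subseq.1 hBpre
  obtain ⟨W, hW, hW0, hwand⟩ | ⟨Z, hZ, hfZ, hZB, C, hCZ, hC, hC0, hCim⟩ :=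
    exists_wandering_or_liminf_image hf hfim hcf hc hc1 hB hB0 hs hBs
  · exact ⟨W, hW, hW0, (tendsto_measure_preimage_of_wandering hf hW hwand).liminf_eq,
      (tendsto_measure_image_of_wandering hfim hinj hW hwand).liminf_eq⟩
  obtain ⟨i, hi⟩ : ∃ i, 0 < μ (C ∩ backwardStage f Z B i) := by
    by_contra! h
    refine hC0.ne' ?_
    rw [← inter_eq_left.2 (hCZ.trans (iUnion_backwardStage hZB).superset), inter_iUnion]
    exact measure_iUnion_null fun i => nonpos_iff_eq_zero.1 (h i)
  refine ⟨_, hC.inter (measurableSet_backwardStage hf hZ hB i), hi, ?_,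
    liminf_eq_zero_mono (fun n => measure_mono (image_mono inter_subset_left)) hCim⟩
  exact liminf_eq_zero_mono (fun n => measure_mono (preimage_mono inter_subset_right))
    (liminf_eq_zero_iff_exists_subseq.2 ⟨s, hs,
      tendsto_measure_preimage_backwardStage hf hfim hcf hc hc1 Z hB hBs i⟩)

/-- If the preimages of `B` are negligible along a subsequence, then the measures of the preimages
of some set oscillate between zero and a positive value. -/
theorem exists_liminf_preimage_limsup_preimage [IsFiniteMeasure μ] (hf : Measurable f)
    (hfim : ∀ B : Set X, MeasurableSet B → MeasurableSet (f '' B))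
    (hcf : ∀ B : Set X, MeasurableSet B → c * μ B ≤ μ (f '' B)) (hc : c ≠ 0) (hc1 : c ≤ 1)
    (hinj : Function.Injective f) {B : Set X} (hB : MeasurableSet B) (hB0 : 0 < μ B)
    (hBpre : atTop.liminf (fun n => μ (f^[n] ⁻¹' B)) = 0) :
    ∃ D, MeasurableSet D ∧ 0 < μ D ∧ atTop.liminf (fun n => μ (f^[n] ⁻¹' D)) = 0 ∧
      0 < atTop.limsup (fun n => μ (f^[n] ⁻¹' D)) := by
  obtain ⟨s, hs, hBs⟩ := liminf_eq_zero_iff_exists_subseq.1 hBpre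
  obtain ⟨W, hW, hW0, hwand⟩ | ⟨Z, hZ, hfZ, hZB, C, hCZ, hC, hC0, hCim⟩ :=
    exists_wandering_or_liminf_image hf hfim hcf hc hc1 hB hB0 hs hBs
  · exact exists_of_wandering hf hfim hcf hc hc1 hinj hW hW0 hwand
  refine exists_liminf_preimage_eq_zero_limsup_pos hf hfim hcf hc hc1 hinj hC hC0 hCim
    (measurableSet_backwardStage hf hZ hB) (monotone_backwardStage Z B) (fun n => ?_) hs
    (tendsto_measure_preimage_backwardStage hf hfim hcf hc hc1 Z hB hBs)
  rw [iUnion_backwardStage hZB, image_subset_iff]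
  exact fun x hx => (mem_iff_iterate_mem hfZ n x).2 (hCZ hx)

end Equivalence

section CompositionOperator

variable {X : Type*} [MeasurableSpace X] {μ : Measure X} {p : ℝ≥0∞} [Fact (1 ≤ p)] {f : X → X}
  {T : Lp ℝ p μ →L[ℝ] Lp ℝ p μ}

theorem coeFn_pow_compositionOperator (hf : Measure.QuasiMeasurePreserving f μ μ)
    (hT : ∀ φ : Lp ℝ p μ, ⇑(T φ) =ᵐ[μ] fun x => φ (f x)) (n : ℕ) (φ : Lp ℝ p μ) :
    ⇑((T ^ n) φ) =ᵐ[μ] fun x => φ (f^[n] x) := by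
  induction n generalizing φ with
  | zero => simp
  | succ n ih =>
    rw [pow_succ]
    refine (ih (T φ)).trans ?_
    simp only [Function.iterate_succ_apply']
    exact (hf.iterate n).ae_eq_comp (hT φ)

theorem norm_pow_compositionOperator_indicator (hp : p ≠ ∞)
    (hf : Measure.QuasiMeasurePreserving f μ μ)
    (hT : ∀ φ : Lp ℝ p μ, ⇑(T φ) =ᵐ[μ] fun x => φ (f x)) (n : ℕ) {B : Set X}
    (hB : MeasurableSet B) (hBfin : μ B ≠ ∞) :
    ‖(T ^ n) (indicatorConstLp p hB hBfin (1 : ℝ))‖ =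
      (μ (f^[n] ⁻¹' B)).toReal ^ (1 / p.toReal) := by
  have hp0 : p ≠ 0 := (zero_lt_one.trans_le (Fact.out : 1 ≤ p)).ne'
  have h : ⇑((T ^ n) (indicatorConstLp p hB hBfin (1 : ℝ))) =ᵐ[μ]
      (f^[n] ⁻¹' B).indicator fun _ => (1 : ℝ) :=
    (coeFn_pow_compositionOperator hf hT n _).trans
      ((hf.iterate n).ae_eq_comp (indicatorConstLp_coeFn (p := p) (hs := hB) (hμs := hBfin)))
  rw [Lp.norm_def, eLpNorm_congr_ae h,
    eLpNorm_indicator_const ((hf.iterate n).measurable hB) hp0 hp, enorm_one, one_mul,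
    ENNReal.toReal_rpow]

theorem exists_liminf_preimage_of_frequently_norm_lt (hp : p ≠ ∞)
    (hf : Measure.QuasiMeasurePreserving f μ μ)
    (hT : ∀ φ : Lp ℝ p μ, ⇑(T φ) =ᵐ[μ] fun x => φ (f x)) {φ : Lp ℝ p μ} (hφ : φ ≠ 0)
    (hlim : ∀ ε > (0 : ℝ), ∃ᶠ n in atTop, ‖(T ^ n) φ‖ < ε) :
    ∃ B : Set X, MeasurableSet B ∧ 0 < μ B ∧
      atTop.liminf (fun n : ℕ => μ (f^[n] ⁻¹' B)) = 0 := by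
  have hp0 : p ≠ 0 := (zero_lt_one.trans_le (Fact.out : 1 ≤ p)).ne'
  have hr : 0 < p.toReal := ENNReal.toReal_pos hp0 hp
  have hφm : Measurable fun x => ‖φ x‖ₑ := (Lp.stronglyMeasurable φ).enorm
  obtain ⟨k, hk⟩ : ∃ k : ℕ, 0 < μ {x | (k : ℝ≥0∞)⁻¹ ≤ ‖φ x‖ₑ} := by
    by_contra! h
    refine hφ ((Lp.eq_zero_iff_ae_eq_zero).2 ?_)
    have h0 : μ (⋃ k : ℕ, {x | (k : ℝ≥0∞)⁻¹ ≤ ‖φ x‖ₑ}) = 0 :=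
      measure_iUnion_null fun k => nonpos_iff_eq_zero.1 (h k)
    refine measure_mono_null (fun x hx => ?_) h0
    obtain ⟨k, hk⟩ := ENNReal.exists_inv_nat_lt (a := ‖φ x‖ₑ) (by simpa using hx)
    exact mem_iUnion.2 ⟨k, hk.le⟩
  set δ : ℝ≥0∞ := (k : ℝ≥0∞)⁻¹ with hδ
  have hδ0 : δ ≠ 0 := by simp [hδ]
  have hδtop : δ ≠ ∞ := by
    intro h
    simp [h, top_le_iff] at hk
  refine ⟨{x | δ ≤ ‖φ x‖ₑ}, measurableSet_le measurable_const hφm, hk,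
    liminf_eq_zero_iff_exists_subseq.2 ?_⟩
  have hlim' : atTop.liminf (fun n => eLpNorm ((T ^ n) φ) p μ) = 0 := by
    refine liminf_eq_zero_iff_frequently_lt.2 fun ε hε => ?_
    obtain ⟨η, hη, hηε⟩ := ENNReal.lt_iff_exists_real_btwn.1 hε
    have hη0 : 0 < η := by simpa using hηε.1
    refine (hlim η hη0).mono fun n hn => lt_of_le_of_lt ?_ hηε.2
    rw [← Lp.enorm_def, ← ofReal_norm]
    exact ENNReal.ofReal_le_ofReal hn.le
  obtain ⟨s, hs, hsl⟩ := liminf_eq_zero_iff_exists_subseq.1 hlim'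
  refine ⟨s, hs, ENNReal.tendsto_zero_of_const_mul_le (a := δ ^ p.toReal) ?_ ?_ (fun n => ?_)
    (v := fun n => eLpNorm ((T ^ s n) φ) p μ ^ p.toReal) ?_⟩
  · exact (ENNReal.rpow_pos (pos_iff_ne_zero.2 hδ0) hδtop).ne'
  · exact ENNReal.rpow_ne_top_of_nonneg hr.le hδtop
  · have hae : f^[s n] ⁻¹' {x | δ ≤ ‖φ x‖ₑ} =ᵐ[μ] {x | δ ≤ ‖((T ^ s n) φ) x‖ₑ} := by
      filter_upwards [coeFn_pow_compositionOperator hf hT (s n) φ] with x hx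
      change (δ ≤ ‖φ (f^[s n] x)‖ₑ) = (δ ≤ ‖((T ^ s n) φ) x‖ₑ)
      rw [hx]
    rw [Function.comp_apply, measure_congr hae]
    exact mul_meas_ge_le_pow_eLpNorm' μ hp0 hp (Lp.aestronglyMeasurable _) δ
  · have h0 := (ENNReal.continuous_rpow_const (y := p.toReal)).tendsto 0
    rw [ENNReal.zero_rpow_of_pos hr] at h0
    exact h0.comp hsl

theorem liYorkeChaotic_of_semiIrregular {E : Type*} [NormedAddCommGroup E] [NormedSpace ℝ E]
    {T : E →L[ℝ] E} {v : E} (h1 : ∀ ε > (0 : ℝ), ∃ᶠ n in atTop, ‖(T ^ n) v‖ < ε)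
    (h2 : ∃ ε > (0 : ℝ), ∃ᶠ n in atTop, ε < ‖(T ^ n) v‖) : LiYorkeChaotic T := by
  have hv : v ≠ 0 := by
    rintro rfl
    obtain ⟨ε, hε, h⟩ := h2
    obtain ⟨n, hn⟩ := h.exists
    rw [map_zero, norm_zero] at hn
    exact hn.not_gt hε
  have hdist : ∀ (n : ℕ) (a b : ℝ),
      dist (T^[n] (a • v)) (T^[n] (b • v)) = |a - b| * ‖(T ^ n) v‖ := by
    intro n a b
    rw [← FunLike.coe_pow_eq_iterate, dist_eq_norm, ← map_sub, ← sub_smul, map_smul, norm_smul,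
      Real.norm_eq_abs]
  refine ⟨range fun a : ℝ => a • v, fun h => ?_, ?_⟩
  · refine not_countable_univ (α := ℝ) ?_
    exact countable_of_injective_of_countable_image (smul_left_injective ℝ hv).injOn
      (by rwa [image_univ])
  · rintro _ ⟨a, rfl⟩ _ ⟨b, rfl⟩ hab
    have hab' : 0 < |a - b| := abs_pos.2 (sub_ne_zero.2 fun h => hab (by rw [h]))
    simp only [hdist]
    refine ⟨fun ε hε => (h1 (ε / |a - b|) (by positivity)).mono fun n hn => ?_, ?_⟩
    · rwa [lt_div_iff₀' hab'] at hn
    · obtain ⟨ε, hε, h⟩ := h2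
      exact ⟨|a - b| * ε, by positivity, h.mono fun n hn => by gcongr⟩

theorem exists_norm_pow_lt_of_liYorkeChaotic {E : Type*} [NormedAddCommGroup E] [NormedSpace ℝ E]
    {T : E →L[ℝ] E} (h : LiYorkeChaotic T) :
    ∃ v, v ≠ 0 ∧ ∀ ε > (0 : ℝ), ∃ᶠ n in atTop, ‖(T ^ n) v‖ < ε := by
  obtain ⟨S, hS, hpair⟩ := h
  obtain ⟨x, hx, y, hy, hxy⟩ : S.Nontrivial := by
    rw [← not_subsingleton_iff]
    exact fun h => hS h.countable
  refine ⟨x - y, sub_ne_zero.2 hxy, fun ε hε => ((hpair x hx y hy hxy).1 ε hε).mono fun n hn => ?_⟩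
  rwa [map_sub, ← dist_eq_norm, FunLike.coe_pow_eq_iterate]

end CompositionOperator

/-- **Theorem 2.** If `μ` is finite and `f` is injective, then the following are
equivalent: (LY1) `T_f` is Li-Yorke chaotic; (LY2) there is a nonzero `φ ∈ L^p` with
`liminf ‖T_f^n φ‖ = 0`; (LY3) there is a measurable `B` with `μ(B) > 0` and
`liminf μ(f^{-n}(B)) = 0`; (LY4) there is a measurable `B` with `μ(B) > 0` and
`liminf μ(f^n(B)) = 0`; (LY5) there is a measurable `B` with `μ(B) > 0`,
`liminf μ(f^{-n}(B)) = 0` and `liminf μ(f^n(B)) = 0`; (LY6) there is a measurable `B`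
with `μ(B) > 0`, `liminf μ(f^{-n}(B)) = 0` and `limsup μ(f^{-n}(B)) > 0`;
(LY7) `T_f` admits a characteristic function as a semi-irregular vector. -/
theorem liYorke_tfae
    {X : Type*} [MeasurableSpace X] (μ : Measure X) (hX : μ Set.univ ≠ 0)
    [IsFiniteMeasure μ]
    (p : ℝ≥0∞) [Fact (1 ≤ p)] (hp : p ≠ ∞)
    (f : X → X) (hf : Measurable f)
    (hfim : ∀ B : Set X, MeasurableSet B → MeasurableSet (f '' B))
    (c : ℝ≥0∞) (hc : 0 < c)
    (hcf : ∀ B : Set X, MeasurableSet B → c * μ B ≤ μ (f '' B))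
    (hinj : Function.Injective f)
    (T : Lp ℝ p μ →L[ℝ] Lp ℝ p μ)
    (hT : ∀ φ : Lp ℝ p μ, ⇑(T φ) =ᵐ[μ] fun x => φ (f x)) :
    List.TFAE [
      -- (LY1)
      LiYorkeChaotic (⇑T),
      -- (LY2)
      ∃ φ : Lp ℝ p μ, φ ≠ 0 ∧ ∀ ε > (0 : ℝ), ∃ᶠ n in atTop, ‖(T ^ n) φ‖ < ε,
      -- (LY3)
      ∃ B : Set X, MeasurableSet B ∧ 0 < μ B ∧
        atTop.liminf (fun n : ℕ => μ (f^[n] ⁻¹' B)) = 0,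
      -- (LY4)
      ∃ B : Set X, MeasurableSet B ∧ 0 < μ B ∧
        atTop.liminf (fun n : ℕ => μ (f^[n] '' B)) = 0,
      -- (LY5)
      ∃ B : Set X, MeasurableSet B ∧ 0 < μ B ∧
        atTop.liminf (fun n : ℕ => μ (f^[n] ⁻¹' B)) = 0 ∧
        atTop.liminf (fun n : ℕ => μ (f^[n] '' B)) = 0,
      -- (LY6)
      ∃ B : Set X, MeasurableSet B ∧ 0 < μ B ∧
        atTop.liminf (fun n : ℕ => μ (f^[n] ⁻¹' B)) = 0 ∧
        0 < atTop.limsup (fun n : ℕ => μ (f^[n] ⁻¹' B)),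
      -- (LY7): some characteristic function is a semi-irregular vector for `T_f`
      ∃ (B : Set X) (hB : MeasurableSet B) (hBfin : μ B ≠ ∞),
        (∀ ε > (0 : ℝ), ∃ᶠ n in atTop,
          ‖(T ^ n) (indicatorConstLp p hB hBfin (1 : ℝ))‖ < ε) ∧
        (∃ ε > (0 : ℝ), ∃ᶠ n in atTop,
          ε < ‖(T ^ n) (indicatorConstLp p hB hBfin (1 : ℝ))‖)
    ] := by
  have hp0 : p ≠ 0 := (zero_lt_one.trans_le (Fact.out : 1 ≤ p)).ne'
  have hr : 0 < 1 / p.toReal := one_div_pos.2 (ENNReal.toReal_pos hp0 hp)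
  have hm : min c 1 ≠ 0 := (lt_min hc zero_lt_one).ne'
  have hcf' : ∀ B : Set X, MeasurableSet B → min c 1 * μ B ≤ μ (f '' B) := fun B hB =>
    (mul_le_mul_left (min_le_left c 1) _).trans (hcf B hB)
  have hqmp : Measure.QuasiMeasurePreserving f μ μ := ⟨hf, Measure.AbsolutelyContinuous.mk
    fun A hA hA0 => by
      rw [Measure.map_apply hf hA]
      exact measure_preimage_iterate_eq_zero hf hfim hcf' hm 1 hA hA0⟩
  have hnorm := fun n (B : Set X) (hB : MeasurableSet B) (hBfin : μ B ≠ ∞) =>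
    norm_pow_compositionOperator_indicator hp hqmp hT n hB hBfin
  tfae_have 1 → 2 := exists_norm_pow_lt_of_liYorkeChaotic
  tfae_have 2 → 3 := fun ⟨φ, hφ, h⟩ => exists_liminf_preimage_of_frequently_norm_lt hp hqmp hT hφ h
  tfae_have 3 → 5 := fun ⟨B, hB, hB0, h⟩ =>
    exists_liminf_preimage_and_image hf hfim hcf' hm (min_le_right _ _) hinj hB hB0 h
  tfae_have 5 → 4 := fun ⟨B, hB, hB0, _, h⟩ => ⟨B, hB, hB0, h⟩
  tfae_have 4 → 3 := fun ⟨B, hB, hB0, h⟩ =>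
    exists_liminf_preimage_of_liminf_image hf hfim hcf' hm (min_le_right _ _) hB hB0 h
  tfae_have 3 → 6 := fun ⟨B, hB, hB0, h⟩ =>
    exists_liminf_preimage_limsup_preimage hf hfim hcf' hm (min_le_right _ _) hinj hB hB0 h
  tfae_have 6 → 7 := by
    rintro ⟨B, hB, hB0, hinf, hsup⟩
    refine ⟨B, hB, measure_ne_top _ _, fun ε hε => ?_, ?_⟩
    · refine (liminf_eq_zero_iff_frequently_lt.1 hinf (ENNReal.ofReal (ε ^ p.toReal))
        (by simpa using Real.rpow_pos_of_pos hε _)).mono fun n hn => ?_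
      rw [hnorm, one_div, Real.rpow_inv_lt_iff_of_pos ENNReal.toReal_nonneg hε.le
        (by simpa using hr)]
      exact (ENNReal.lt_ofReal_iff_toReal_lt (measure_ne_top _ _)).1 hn
    · obtain ⟨δ, hδ0, hδ⟩ := exists_between hsup
      have hδtop : δ ≠ ∞ := hδ.ne_top
      refine ⟨δ.toReal ^ (1 / p.toReal),
        Real.rpow_pos_of_pos (ENNReal.toReal_pos hδ0.ne' hδtop) _, ?_⟩
      refine (frequently_lt_of_lt_limsup (by isBoundedDefault) hδ).mono fun n hn => ?_
      rw [hnorm]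
      exact Real.rpow_lt_rpow ENNReal.toReal_nonneg
        ((ENNReal.toReal_lt_toReal hδtop (measure_ne_top _ _)).2 hn) hr
  tfae_have 7 → 1 := fun ⟨_, _, _, h1, h2⟩ => liYorkeChaotic_of_semiIrregular h1 h2
  tfae_finish
end
end
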